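/- Let n ≥ 2 be an integer and q a prime power with (n,q) ∉ {(2,2),(2,3)}, and let p be a prime with p | (q−1) and p > n(n−1). Then for every irreducible complex character χ of SL_n(F_q) (the group of n×n matrices of determinant 1 over the field with q elements) with p ∤ χ(1), Property 1.3 holds for (SL_n(F_q), χ, p). -/

import Mathlib

open CategoryTheory

/-- `Qcyc N` is the `N`-th cyclotomic field `ℚ(ζ_N)`, realised as the subfield of `ℂ`
generated by all `N`-th roots of unity. -/
noncomputable def Qcyc (N : ℕ) : IntermediateField ℚ ℂ :=
  IntermediateField.adjoin ℚ {z : ℂ | z ^ N = 1}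

/-- `Qadj c` is the subfield `ℚ(c)` of `ℂ` generated by a complex number `c`. -/
noncomputable def Qadj (c : ℂ) : IntermediateField ℚ ℂ :=
  IntermediateField.adjoin ℚ {c}

/-- `f` is the conductor of the complex number `c`: the least positive integer `N`
with `c ∈ ℚ(ζ_N)`. -/
def IsConductorOf (c : ℂ) (f : ℕ) : Prop :=
  IsLeast {N : ℕ | 0 < N ∧ c ∈ Qcyc N} f

/-- `f` is the conductor of the character `χ`: the least positive integer `N` such that all
values of `χ` lie in `ℚ(ζ_N)`. -/
def IsCharConductor {G : Type*} [Monoid G] (χ : G → ℂ) (f : ℕ) : Prop :=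
  IsLeast {N : ℕ | 0 < N ∧ ∀ g, χ g ∈ Qcyc N} f

/-- Property 1.3 of Navarro–Tiep for `(G, χ, p)`: writing the conductor of `χ` as
`f = p ^ a * m` with `p ∤ m` (so that `p ^ a = p ^ (f.factorization p)` is the `p`-part of `f`),
there is a `p`-element `g ∈ G` such that `p ∤ [ℚ(ζ_{p^a}) : ℚ(χ(g))]`. -/
def Property13 {G : Type*} [Group G] (χ : G → ℂ) (p : ℕ) : Prop :=
  ∀ f : ℕ, IsCharConductor χ f →
    ∃ g : G, (∃ j : ℕ, orderOf g = p ^ j) ∧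
      ¬ p ∣ (Qadj (χ g)).relfinrank (Qcyc (p ^ f.factorization p))

open CategoryTheory

theorem fdrep_span {G : Type} [Group G] (V : FDRep ℂ G) (hV : Simple V) (v : V) (hv : v ≠ 0) :
    Submodule.span ℂ (Set.range fun g : G => V.ρ g v) = ⊤ := by
  set W : Submodule ℂ V := Submodule.span ℂ (Set.range fun g : G => V.ρ g v) with hW
  have hinv : ∀ g : G, ∀ w ∈ W, V.ρ g w ∈ W := by
    intro g w hw
    refine Submodule.span_induction (p := fun w _ => V.ρ g w ∈ W) ?_ ?_ ?_ ?_ hw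
    · rintro _ ⟨h, rfl⟩
      refine Submodule.subset_span ⟨g * h, ?_⟩
      simp
    · simp
    · intro x y _ _ hx hy
      rw [map_add]; exact W.add_mem hx hy
    · intro a x _ hx
      rw [map_smul]; exact W.smul_mem a hx
  let σ : Representation ℂ G W :=
    { toFun := fun g => (V.ρ g).restrict (hinv g)
      map_one' := by ext x; simp
      map_mul' := by intro g h; ext x; simp }
  let f : FDRep.of σ ⟶ V :=
    ⟨InducedCategory.homMk (ModuleCat.ofHom W.subtype), fun g => by
      ext1; ext1; rfl⟩
  have hmono : Mono f := by
    apply (Action.forget _ _).mono_of_mono_map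
    apply ConcreteCategory.mono_of_injective
    exact Subtype.val_injective
  have hne : f ≠ 0 := by
    intro h0
    have hvW : v ∈ W := Submodule.subset_span ⟨1, by simp⟩
    have := congrArg (fun k : FDRep.of σ ⟶ V => k.hom.hom.hom ⟨v, hvW⟩) h0
    exact hv this
  have hiso : IsIso f := isIso_of_mono_of_nonzero hne
  let e := FDRep.isoToLinearEquiv (asIso f)
  rw [eq_top_iff]
  intro x _
  obtain ⟨y, hy⟩ := e.surjective x
  have : ((e y : V)) = (y : W).1 := rfl
  rw [← hy, this]
  exact (y : W).2

open CategoryTheory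

theorem Qcyc_isCyc (N : ℕ) (hN : 0 < N) : IsCyclotomicExtension {N} ℚ (Qcyc N) := by
  have : NeZero N := ⟨hN.ne'⟩
  have hζ := Complex.isPrimitiveRoot_exp N hN.ne'
  refine (IntermediateField.isCyclotomicExtension_singleton_iff_eq_adjoin N ℚ ℂ _ hζ).2 ?_
  apply le_antisymm
  · rw [Qcyc, IntermediateField.adjoin_le_iff]
    intro z hz
    obtain ⟨i, _, rfl⟩ := hζ.eq_pow_of_pow_eq_one hz
    exact pow_mem (IntermediateField.mem_adjoin_simple_self ℚ _) i
  · rw [IntermediateField.adjoin_simple_le_iff]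
    exact IntermediateField.subset_adjoin _ _ hζ.pow_eq_one

theorem Qcyc_finrank (N : ℕ) (hN : 0 < N) : Module.finrank ℚ (Qcyc N) = N.totient := by
  have : NeZero N := ⟨hN.ne'⟩
  have := Qcyc_isCyc N hN
  exact IsCyclotomicExtension.finrank (n := N) (Qcyc N) (Polynomial.cyclotomic.irreducible_rat hN)

theorem Qcyc_mem (N : ℕ) (z : ℂ) (hz : z ^ N = 1) : z ∈ Qcyc N :=
  IntermediateField.subset_adjoin _ _ hz

theorem Qcyc_mono {M N : ℕ} (h : M ∣ N) : Qcyc M ≤ Qcyc N := by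
  rw [Qcyc, IntermediateField.adjoin_le_iff]
  intro z hz
  obtain ⟨k, rfl⟩ := h
  apply Qcyc_mem
  rw [pow_mul, show z ^ M = 1 from hz, one_pow]

theorem Qcyc_inf (M N : ℕ) (hM : 0 < M) (hN : 0 < N) : Qcyc M ⊓ Qcyc N = Qcyc (M.gcd N) := by
  have : NeZero N := ⟨hN.ne'⟩
  have : NeZero M := ⟨hM.ne'⟩
  have := Qcyc_isCyc N hN
  have := Qcyc_isCyc M hM
  have hg : 0 < M.gcd N := Nat.gcd_pos_of_pos_left _ hM
  have hl : 0 < M.lcm N := Nat.lcm_pos hM hN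
  have : NeZero (M.lcm N) := ⟨hl.ne.symm⟩
  have := Qcyc_isCyc _ hl
  have hsup : Qcyc M ⊔ Qcyc N = Qcyc (M.lcm N) := by
    have := IntermediateField.isCyclotomicExtension_lcm_sup (K := ℚ) (L := ℂ) (n₁ := M) (n₂ := N) (Qcyc M) (Qcyc N) (h₁ := Qcyc_isCyc M hM) (h₂ := Qcyc_isCyc N hN)
    exact IntermediateField.isCyclotomicExtension_eq {M.lcm N} ℚ ℂ _ _ (h₁ := this) (h₂ := Qcyc_isCyc _ hl)
  have : FiniteDimensional ℚ (Qcyc M) := IsCyclotomicExtension.finite_of_singleton M ℚ _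
  have : FiniteDimensional ℚ (Qcyc N) := IsCyclotomicExtension.finite_of_singleton N ℚ _
  have : FiniteDimensional ℚ (Qcyc (M.lcm N)) :=
    IsCyclotomicExtension.finite_of_singleton (M.lcm N) ℚ _
  set D := Qcyc M ⊓ Qcyc N with hD
  have hDM : D ≤ Qcyc M := inf_le_left
  have hDN : D ≤ Qcyc N := inf_le_right
  have : FiniteDimensional ℚ D :=
    Module.Finite.of_injective (IntermediateField.inclusion hDM).toLinearMap
      (IntermediateField.inclusion hDM).injective
  have key : ∀ (A : IntermediateField ℚ ℂ) (h : D ≤ A), Module.finrank ℚ D *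
      Module.finrank D (IntermediateField.extendScalars h) = Module.finrank ℚ A := by
    intro A h
    rw [← IntermediateField.relfinrank_eq_finrank_of_le, ← IntermediateField.relfinrank_bot_left,
      ← IntermediateField.relfinrank_bot_left]
    exact IntermediateField.relfinrank_mul_relfinrank bot_le h
  have hDL : D ≤ Qcyc (M.lcm N) := hDM.trans (Qcyc_mono (Nat.dvd_lcm_left _ _))
  have hs2 : IntermediateField.extendScalars hDM ⊔ IntermediateField.extendScalars hDN =
      IntermediateField.extendScalars hDL := by
    rw [IntermediateField.extendScalars_sup]
    congr 1
  have h1 := IntermediateField.finrank_sup_le (IntermediateField.extendScalars hDM)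
    (IntermediateField.extendScalars hDN)
  rw [hs2] at h1
  have k1 := key _ hDM
  have k2 := key _ hDN
  have k3 := key _ hDL
  rw [Qcyc_finrank _ hM] at k1
  rw [Qcyc_finrank _ hN] at k2
  rw [Qcyc_finrank _ hl] at k3
  have htot : (M.gcd N).totient * (M.lcm N).totient = M.totient * N.totient := by
    have h1 := Nat.totient_gcd_mul_totient_mul M N
    have h2 := Nat.totient_gcd_mul_totient_mul (M.gcd N) (M.lcm N)
    have h3 : (M.gcd N).gcd (M.lcm N) = M.gcd N :=
      Nat.gcd_eq_left ((Nat.gcd_dvd_left M N).trans (Nat.dvd_lcm_left M N))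
    rw [h3, Nat.gcd_mul_lcm, h1] at h2
    exact (Nat.eq_of_mul_eq_mul_right hg h2).symm
  have hle : Module.finrank ℚ D ≤ (M.gcd N).totient := by
    have : 0 < (M.lcm N).totient := Nat.totient_pos.2 hl
    apply Nat.le_of_mul_le_mul_right _ this
    rw [htot, ← k3, ← k1, ← k2]
    nlinarith [Nat.mul_le_mul_left (Module.finrank ℚ D * Module.finrank ℚ D) h1]
  symm
  apply IntermediateField.eq_of_le_of_finrank_le
  · exact le_inf (Qcyc_mono (Nat.gcd_dvd_left _ _)) (Qcyc_mono (Nat.gcd_dvd_right _ _))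
  · rw [Qcyc_finrank _ hg]; exact hle

open CategoryTheory

theorem exists_red (p : ℕ) (hp : p.Prime) : ∃ (k : Type) (_ : Field k) (_ : CharP k p),
    Nonempty (integralClosure ℤ ℂ →+* k) := by
  have hnu : ¬ IsUnit ((p : ℕ) : integralClosure ℤ ℂ) := by
    intro h
    obtain ⟨u, hu⟩ := h.exists_right_inv
    have h1 : ((p : ℂ)) * (u : ℂ) = 1 := by
      have := congrArg (Subtype.val) hu
      simpa using this
    have h2 : (u : ℂ) = algebraMap ℚ ℂ (1 / p) := by
      have hp0 : (p : ℂ) ≠ 0 := by exact_mod_cast hp.ne_zero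
      rw [map_div₀, map_one, map_natCast, eq_div_iff hp0, mul_comm]; exact h1
    have h3 : IsIntegral ℤ (algebraMap ℚ ℂ (1 / p)) := h2 ▸ u.2
    have h4 : IsIntegral ℤ (1 / p : ℚ) := (isIntegral_algebraMap_iff (algebraMap ℚ ℂ).injective).1 h3
    obtain ⟨m, hm⟩ := IsIntegrallyClosed.isIntegral_iff.1 h4
    have hp0 : (p : ℚ) ≠ 0 := by exact_mod_cast hp.ne_zero
    have h5 : (m : ℚ) * p = 1 := by
      have : (m : ℚ) = 1 / p := by simpa using hm
      rw [this]; field_simp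
    have h6 : m * (p : ℤ) = 1 := by exact_mod_cast h5
    have h7 : (p : ℤ) ∣ 1 := ⟨m, by linarith⟩
    have h8 : p ∣ 1 := by exact_mod_cast h7
    exact hp.one_lt.ne' (Nat.dvd_one.1 h8)
  obtain ⟨M, hM, hpM⟩ := exists_max_ideal_of_mem_nonunits (show _ ∈ nonunits _ from hnu)
  let _ := Ideal.Quotient.field M
  refine ⟨integralClosure ℤ ℂ ⧸ M, inferInstance, ?_, ⟨Ideal.Quotient.mk M⟩⟩
  have : ((p : ℕ) : integralClosure ℤ ℂ ⧸ M) = 0 := by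
    have := Ideal.Quotient.eq_zero_iff_mem.2 hpM
    simpa using this
  exact (CharP.charP_iff_prime_eq_zero hp).2 this

theorem red_card (p : ℕ) (hp : p.Prime) (s t : Multiset ℂ)
    (hs : ∀ z ∈ s, ∃ k : ℕ, z ^ p ^ k = 1) (ht : ∀ z ∈ t, ∃ k : ℕ, z ^ p ^ k = 1)
    (h : s.sum = t.sum) : s.card ≡ t.card [MOD p] := by
  obtain ⟨k, _, _, ⟨r⟩⟩ := exists_red p hp
  have key : ∀ s : Multiset ℂ, (∀ z ∈ s, ∃ k : ℕ, z ^ p ^ k = 1) →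
      ∃ o : integralClosure ℤ ℂ, (o : ℂ) = s.sum ∧ r o = (s.card : k) := by
    intro s
    induction s using Multiset.induction with
    | empty => intro _; exact ⟨0, by simp, by simp⟩
    | cons a s ih =>
      intro hs
      obtain ⟨o, ho1, ho2⟩ := ih fun z hz => hs z (Multiset.mem_cons_of_mem hz)
      obtain ⟨j, hj⟩ := hs a (Multiset.mem_cons_self a s)
      have ha : IsIntegral ℤ a := by
        apply IsIntegral.of_pow (n := p ^ j) (pow_pos hp.pos _)
        rw [hj]; exact isIntegral_one
      refine ⟨⟨a, ha⟩ + o, ?_, ?_⟩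
      · rw [Multiset.sum_cons, ← ho1]; rfl
      · have h1 : (⟨a, ha⟩ : integralClosure ℤ ℂ) ^ p ^ j = 1 := Subtype.ext (by simpa using hj)
        have h2 : r ⟨a, ha⟩ ^ p ^ j = 1 := by rw [← map_pow, h1, map_one]
        have : Fact p.Prime := ⟨hp⟩
        have h3 : (r ⟨a, ha⟩ - 1) ^ p ^ j = 0 := by rw [sub_pow_char_pow, h2]; simp
        have h4 : r ⟨a, ha⟩ = 1 := sub_eq_zero.1 (pow_eq_zero_iff (pow_pos hp.pos _).ne' |>.1 h3)
        rw [map_add, h4, ho2, Multiset.card_cons]; push_cast; ring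
  obtain ⟨o1, h1, h1'⟩ := key s hs
  obtain ⟨o2, h2, h2'⟩ := key t ht
  have : o1 = o2 := Subtype.ext (by rw [h1, h2, h])
  rw [this, h2'] at h1'
  exact ((CharP.natCast_eq_natCast k p).1 h1').symm

theorem lte_one (p c s : ℕ) (hp : p.Prime) (hp2 : Odd p) (hc : 1 ≤ c)
    (h : (p ^ c : ℤ) ∣ (s : ℤ) ^ p - 1) : (p ^ (c - 1) : ℤ) ∣ (s : ℤ) - 1 := by
  have : Fact p.Prime := ⟨hp⟩
  have hps : (p : ℤ) ∣ (s : ℤ) - 1 := by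
    have h1 : (p : ℤ) ∣ (s : ℤ) ^ p - 1 := (dvd_pow_self _ (by omega)).trans h
    have h2 := (ZMod.intCast_zmod_eq_zero_iff_dvd _ p).2 h1
    rw [← ZMod.intCast_zmod_eq_zero_iff_dvd]
    push_cast at h2 ⊢
    rwa [ZMod.pow_card] at h2
  have hns : ¬ (p : ℤ) ∣ (s : ℤ) := by
    intro h'
    have h3 : (p : ℤ) ∣ 1 := by
      have := dvd_sub h' hps
      simpa using this
    have h8 : p ∣ 1 := by exact_mod_cast h3
    exact hp.one_lt.ne' (Nat.dvd_one.1 h8)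
  have h4 := Int.emultiplicity_pow_sub_pow hp hp2 (x := s) (y := 1) (by simpa using hps) hns p
  rw [one_pow] at h4
  rw [Nat.Prime.emultiplicity_self hp] at h4
  have h6 := le_emultiplicity_of_pow_dvd h
  rw [h4] at h6
  apply pow_dvd_of_le_emultiplicity
  obtain ⟨d, rfl⟩ : ∃ d, c = d + 1 := ⟨c - 1, by omega⟩
  simp only [Nat.add_sub_cancel]
  push_cast at h6
  exact (ENat.add_le_add_iff_right (by simp)).1 h6

open CategoryTheory

theorem prim_modEq {M : Type*} [Field M] {ζ : M} {N : ℕ} (hN : 0 < N) (h : IsPrimitiveRoot ζ N) (a b : ℕ)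
    (hab : ζ ^ a = ζ ^ b) : a ≡ b [MOD N] := by
  obtain rfl := h.eq_orderOf
  have h0 : ζ ≠ 0 := h.ne_zero hN.ne'
  have : orderOf (Units.mk0 ζ h0) = orderOf ζ := by rw [← orderOf_units]; rfl
  rw [← this]
  apply pow_eq_pow_iff_modEq.1
  ext; simpa using hab

theorem gal_exists (p c : ℕ) (hp : p.Prime) (hp2 : Odd p) (hc : 2 ≤ c)
    (K : IntermediateField ℚ ℂ) (hK : K ≤ Qcyc (p ^ c))
    (hd : p ∣ K.relfinrank (Qcyc (p ^ c))) :
    ∃ (k : ℕ) (σ : Qcyc (p ^ c) →+* Qcyc (p ^ c)), ¬ p ∣ k ∧ (∀ z : Qcyc (p ^ c), (z : ℂ) ∈ K → σ z = z) ∧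
      ∀ z : Qcyc (p ^ c), z ^ p ^ c = 1 → σ z = z * (z ^ p ^ (c - 1)) ^ k := by
  have : Fact p.Prime := ⟨hp⟩
  have hN : 0 < p ^ c := pow_pos hp.pos c
  have : NeZero (p ^ c) := ⟨hN.ne'⟩
  have hcyc := Qcyc_isCyc (p ^ c) hN
  rw [IntermediateField.relfinrank_eq_finrank_of_le hK] at hd
  have hfin : FiniteDimensional ℚ (Qcyc (p ^ c)) :=
    IsCyclotomicExtension.finite_of_singleton (p ^ c) ℚ _
  have hgal : IsGalois ℚ (Qcyc (p ^ c)) := IsCyclotomicExtension.isGalois {p ^ c} ℚ _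
  have hgal' : IsGalois ℚ (IntermediateField.extendScalars hK) := hgal
  have hfin' : FiniteDimensional ℚ (IntermediateField.extendScalars hK) := hfin
  have hgalK : IsGalois K (IntermediateField.extendScalars hK) :=
    IsGalois.tower_top_of_isGalois ℚ K _
  have hfinK : FiniteDimensional K (IntermediateField.extendScalars hK) :=
    FiniteDimensional.right ℚ K _
  rw [← IsGalois.card_aut_eq_finrank] at hd
  obtain ⟨σ, hσ⟩ := exists_prime_orderOf_dvd_card' p hd
  have hζ' := Complex.isPrimitiveRoot_exp (p ^ c) hN.ne'
  let ζ : Qcyc (p ^ c) := ⟨_, Qcyc_mem _ _ hζ'.pow_eq_one⟩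
  have hζ : IsPrimitiveRoot ζ (p ^ c) :=
    IsPrimitiveRoot.of_map_of_injective (f := (Qcyc (p ^ c)).val) hζ' Subtype.val_injective
  let τ0 : (IntermediateField.extendScalars hK) →+* (IntermediateField.extendScalars hK) :=
    σ.toRingEquiv.toRingHom
  let τ : Qcyc (p ^ c) →+* Qcyc (p ^ c) := τ0
  have hτK : ∀ z : Qcyc (p ^ c), (z : ℂ) ∈ K → τ z = z := by
    intro z hz
    exact σ.commutes ⟨z, hz⟩
  obtain ⟨s, hs, hsζ⟩ := hζ.eq_pow_of_pow_eq_one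
    (show (τ ζ) ^ p ^ c = 1 by rw [← map_pow, hζ.pow_eq_one, map_one])
  have hall : ∀ z : Qcyc (p ^ c), z ^ p ^ c = 1 → τ z = z ^ s := by
    intro z hz
    obtain ⟨i, _, rfl⟩ := hζ.eq_pow_of_pow_eq_one hz
    rw [map_pow, ← hsζ, ← pow_mul, ← pow_mul, mul_comm]
  have hiter : ∀ j : ℕ, (τ ^ j : Qcyc (p ^ c) →+* Qcyc (p ^ c)) ζ = ζ ^ s ^ j := by
    intro j
    induction j with
    | zero => simp
    | succ j ih =>
      rw [pow_succ', RingHom.mul_def, RingHom.comp_apply, ih, map_pow, ← hsζ, ← pow_mul, ← pow_succ']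
  have hτσ : ∀ j : ℕ, ∀ z : Qcyc (p ^ c),
      (τ ^ j : Qcyc (p ^ c) →+* Qcyc (p ^ c)) z = (σ ^ j) z := by
    intro j
    induction j with
    | zero => intro z; simp; rfl
    | succ j ih =>
      intro z
      rw [pow_succ', RingHom.mul_def, RingHom.comp_apply, ih, pow_succ' σ]; rfl
  have hp1 : ζ ^ s ^ p = ζ := by
    have h0 : σ ^ p = 1 := orderOf_dvd_iff_pow_eq_one.1 (dvd_of_eq hσ)
    rw [← hiter, hτσ, h0]; rfl
  have hdvd : (p ^ c : ℤ) ∣ (s : ℤ) ^ p - 1 := by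
    have h1 : ζ ^ s ^ p = ζ ^ 1 := by rw [hp1, pow_one]
    have h3 : (s ^ p) ≡ 1 [MOD p ^ c] := prim_modEq hN hζ _ _ h1
    have := (Nat.modEq_iff_dvd.1 h3.symm)
    exact_mod_cast this
  have hdvd' := lte_one p c s hp hp2 (by omega) hdvd
  have hs1 : 1 ≤ s := by
    by_contra h0
    have : s = 0 := by omega
    subst this
    rw [zero_pow hp.ne_zero, pow_zero] at hp1
    exact hζ.ne_one (Nat.one_lt_pow (by omega) hp.one_lt) hp1.symm
  have hdn : p ^ (c - 1) ∣ s - 1 := by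
    have : (p ^ (c - 1) : ℤ) ∣ ((s - 1 : ℕ) : ℤ) := by rw [Nat.cast_sub hs1]; exact_mod_cast hdvd'
    exact_mod_cast this
  obtain ⟨k, hk⟩ := hdn
  have hsk : s = 1 + p ^ (c - 1) * k := by omega
  refine ⟨k, τ, ?_, hτK, ?_⟩
  · rintro ⟨l, rfl⟩
    have h1 : τ ζ = ζ := by
      rw [← hsζ, hsk, pow_add, pow_one, ← mul_assoc, ← pow_succ, Nat.sub_add_cancel (by omega),
        pow_mul, hζ.pow_eq_one, one_pow, mul_one]
    have h2 : σ = 1 := by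
      apply AlgEquiv.ext
      have h3 : ∀ z : Qcyc (p ^ c), τ z = z := by
        let τ' : Qcyc (p ^ c) →ₐ[ℚ] Qcyc (p ^ c) := τ.toRatAlgHom
        have : τ' = AlgHom.id ℚ _ := by
          have htop := IsCyclotomicExtension.adjoin_primitive_root_eq_top (A := ℚ) hζ
          apply AlgHom.ext_of_adjoin_eq_top htop
          intro z hz
          rw [Set.mem_singleton_iff] at hz
          subst hz
          exact h1
        intro z
        exact congrArg (fun f : Qcyc (p ^ c) →ₐ[ℚ] Qcyc (p ^ c) => f z) this
      exact h3
    rw [h2, orderOf_one] at hσ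
    exact hp.one_lt.ne hσ
  · intro z hz
    rw [hall z hz, hsk, pow_add, pow_one, pow_mul]

theorem class_sum_zero (p c : ℕ) (hp : p.Prime) (hp2 : Odd p) (hc : 2 ≤ c)
    (K : IntermediateField ℚ ℂ) (hK : K ≤ Qcyc (p ^ c))
    (hd : p ∣ K.relfinrank (Qcyc (p ^ c))) {ι : Type*} [Fintype ι] (l : ι → ℂ)
    (hl : ∀ i, l i ^ p ^ c = 1) (hS : ∑ i, l i ∈ K) (ξ : ℂ) (hξ : ξ ^ p = 1) (hξ1 : ξ ≠ 1)
    [DecidablePred fun i => l i ^ p ^ (c - 1) = ξ] :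
    ∑ i with l i ^ p ^ (c - 1) = ξ, l i = 0 := by
  obtain ⟨k, σ, hk, hσK, hσ⟩ := gal_exists p c hp hp2 hc K hK hd
  set P := p ^ (c - 1) with hP
  have hPp : P * p = p ^ c := by rw [hP, ← pow_succ, Nat.sub_add_cancel (by omega)]
  have hPP : p ^ c ∣ P * P := by
    rw [hP, ← pow_add]; exact pow_dvd_pow _ (by omega)
  let L : ι → Qcyc (p ^ c) := fun i => ⟨l i, Qcyc_mem _ _ (hl i)⟩
  have hL : ∀ i, L i ^ p ^ c = 1 := fun i => Subtype.ext (by simpa [L] using hl i)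
  have hstep : ∀ j : ℕ, ∑ i, L i * (L i ^ P) ^ (k * j) = ∑ i, L i := by
    intro j
    induction j with
    | zero => simp
    | succ j ih =>
      have h1 : σ (∑ i, L i) = ∑ i, L i := by
        apply hσK
        have : ((∑ i, L i : Qcyc (p ^ c)) : ℂ) = ∑ i, l i := by simp [L]
        rw [this]; exact hS
      rw [← ih, map_sum] at h1
      rw [← ih, ← h1]
      refine Finset.sum_congr rfl fun i _ => ?_
      rw [map_mul, map_pow, map_pow, hσ _ (hL i)]
      have h2 : (L i * (L i ^ P) ^ k) ^ P = L i ^ P := by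
        rw [mul_pow, ← pow_mul, ← pow_mul]
        obtain ⟨r, hr⟩ := hPP
        have : P * (k * P) = p ^ c * (r * k) := by
          calc P * (k * P) = (P * P) * k := by ring
            _ = _ := by rw [hr]; ring
        rw [this, pow_mul, hL, one_pow, mul_one]
      rw [h2, mul_assoc, ← pow_add]
      congr 2; ring
  have hstep' : ∀ j : ℕ, ∑ i, l i * (l i ^ P) ^ (k * j) = ∑ i, l i := by
    intro j
    have := congrArg (Subtype.val) (hstep j)
    simpa [L] using this
  have hgeo : ∀ w : ℂ, w ^ p = 1 → w ≠ 1 → ∑ j ∈ Finset.range p, w ^ j = 0 := by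
    intro w h1 h2
    have := mul_geom_sum w p
    rw [h1, sub_self] at this
    exact (mul_eq_zero.1 this).resolve_left (sub_ne_zero.2 h2)
  have hcop : ∀ w : ℂ, w ^ p = 1 → w ^ k = 1 → w = 1 := by
    intro w h1 h2
    have h3 : orderOf w ∣ p := orderOf_dvd_of_pow_eq_one h1
    have h4 : orderOf w ∣ k := orderOf_dvd_of_pow_eq_one h2
    have h5 := Nat.dvd_gcd h3 h4
    rw [(Nat.Prime.coprime_iff_not_dvd hp).2 hk] at h5
    exact orderOf_eq_one_iff.1 (Nat.dvd_one.1 h5)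
  have hξ0 : ξ ≠ 0 := by
    rintro rfl
    rw [zero_pow hp.ne_zero] at hξ
    exact zero_ne_one hξ
  have h0 : ∑ j ∈ Finset.range p, ((ξ⁻¹) ^ k) ^ j * ∑ i, l i * (l i ^ P) ^ (k * j) = 0 := by
    simp_rw [hstep']
    rw [← Finset.sum_mul, hgeo, zero_mul]
    · rw [← pow_mul, mul_comm, pow_mul, inv_pow, hξ, inv_one, one_pow]
    · intro h
      apply hξ1
      rw [inv_pow, inv_eq_one] at h
      exact hcop ξ hξ h
  simp_rw [Finset.mul_sum] at h0
  rw [Finset.sum_comm] at h0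
  have h1 : ∀ i, ∑ j ∈ Finset.range p, ((ξ⁻¹) ^ k) ^ j * (l i * (l i ^ P) ^ (k * j)) =
      if l i ^ P = ξ then (p : ℂ) * l i else 0 := by
    intro i
    have h2 : ∀ j, ((ξ⁻¹) ^ k) ^ j * (l i * (l i ^ P) ^ (k * j)) =
        l i * (((ξ⁻¹ * l i ^ P) ^ k) ^ j) := by
      intro j; rw [mul_pow, mul_pow, ← pow_mul (l i ^ P)]; ring
    simp_rw [h2]
    rw [← Finset.mul_sum]
    have hlp : (l i ^ P) ^ p = 1 := by rw [← pow_mul, hPp, hl]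
    have hw : (ξ⁻¹ * l i ^ P) ^ p = 1 := by rw [mul_pow, hlp, inv_pow, hξ]; simp
    split_ifs with h
    · rw [h, inv_mul_cancel₀ hξ0]; simp [mul_comm]
    · rw [hgeo, mul_zero]
      · rw [← pow_mul, mul_comm k p, pow_mul, hw, one_pow]
      · intro h3
        apply h
        have := hcop _ hw h3
        rw [inv_mul_eq_one₀ hξ0] at this
        exact this.symm
  simp_rw [h1] at h0
  rw [← Finset.sum_filter, ← Finset.mul_sum] at h0
  have h9 := (mul_eq_zero.1 h0).resolve_left (by exact_mod_cast hp.ne_zero)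
  convert h9

open CategoryTheory

section avg
variable {G : Type} [Group G] [Fintype G] {W : Type} [AddCommGroup W] [Module ℂ W]

open Classical in
/-- Projection onto the fixed vectors of a subgroup. -/
noncomputable def pavg (ρ : G →* Module.End ℂ W) (H : Subgroup G) : Module.End ℂ W :=
  ((Fintype.card H : ℂ)⁻¹) • ∑ h : H, ρ h

theorem pavg_left (ρ : G →* Module.End ℂ W) (H : Subgroup G) (h : G) (hh : h ∈ H) :
    ρ h * pavg ρ H = pavg ρ H := by
  classical
  unfold pavg
  rw [mul_smul_comm, Finset.mul_sum]
  congr 1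
  simp_rw [← map_mul]
  exact Fintype.sum_equiv (Equiv.mulLeft ⟨h, hh⟩) _ _ (fun x => rfl)

theorem pavg_right (ρ : G →* Module.End ℂ W) (H : Subgroup G) (h : G) (hh : h ∈ H) :
    pavg ρ H * ρ h = pavg ρ H := by
  classical
  unfold pavg
  rw [smul_mul_assoc, Finset.sum_mul]
  congr 1
  simp_rw [← map_mul]
  exact Fintype.sum_equiv (Equiv.mulRight ⟨h, hh⟩) _ _ (fun x => rfl)

theorem pavg_absorb (ρ : G →* Module.End ℂ W) (H : Subgroup G) (P : Module.End ℂ W)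
    (h : ∀ h ∈ H, ρ h * P = P) : pavg ρ H * P = P := by
  classical
  unfold pavg
  rw [smul_mul_assoc, Finset.sum_mul, Finset.sum_congr rfl (fun (x : H) _ => h x x.2)]
  rw [Finset.sum_const, Finset.card_univ, ← Nat.cast_smul_eq_nsmul ℂ, smul_smul, inv_mul_cancel₀, one_smul]
  exact_mod_cast Fintype.card_ne_zero

theorem pavg_absorb' (ρ : G →* Module.End ℂ W) (H : Subgroup G) (P : Module.End ℂ W)
    (h : ∀ h ∈ H, P * ρ h = P) : P * pavg ρ H = P := by
  classical
  unfold pavg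
  rw [mul_smul_comm, Finset.mul_sum, Finset.sum_congr rfl (fun (x : H) _ => h x x.2)]
  rw [Finset.sum_const, Finset.card_univ, ← Nat.cast_smul_eq_nsmul ℂ, smul_smul, inv_mul_cancel₀, one_smul]
  exact_mod_cast Fintype.card_ne_zero

theorem pavg_idem (ρ : G →* Module.End ℂ W) (H : Subgroup G) :
    pavg ρ H * pavg ρ H = pavg ρ H := pavg_absorb ρ H _ (fun h hh => pavg_left ρ H h hh)

theorem pavg_fix (ρ : G →* Module.End ℂ W) (H : Subgroup G) (w : W) (h : ∀ h ∈ H, ρ h w = w) :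
    pavg ρ H w = w := by
  classical
  unfold pavg
  rw [LinearMap.smul_apply, LinearMap.sum_apply, Finset.sum_congr rfl (fun (x : H) _ => h x x.2)]
  rw [Finset.sum_const, Finset.card_univ, ← Nat.cast_smul_eq_nsmul ℂ, smul_smul, inv_mul_cancel₀, one_smul]
  exact_mod_cast Fintype.card_ne_zero

theorem pavg_comm_of (ρ : G →* Module.End ℂ W) (H : Subgroup G) (A : Module.End ℂ W)
    (h : ∀ h ∈ H, A * ρ h = ρ h * A) : A * pavg ρ H = pavg ρ H * A := by
  classical
  unfold pavg
  rw [smul_mul_assoc, mul_smul_comm, Finset.sum_mul, Finset.mul_sum]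
  rw [Finset.sum_congr rfl (fun (x : H) _ => h x x.2)]

/-- conjugation as an equivalence of a normalized subgroup -/
theorem pavg_conj (ρ : G →* Module.End ℂ W) (H : Subgroup G) (g : G)
    (hg : ∀ h ∈ H, g * h * g⁻¹ ∈ H) : ρ g * pavg ρ H = pavg ρ H * ρ g := by
  classical
  have hinj : Function.Injective (fun h : H => (⟨g * h * g⁻¹, hg h h.2⟩ : H)) := by
    intro a b hab
    have := congrArg Subtype.val hab
    simp only at this
    exact Subtype.ext (mul_left_cancel (mul_right_cancel this))
  have hbij := Finite.injective_iff_bijective.1 hinj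
  unfold pavg
  rw [smul_mul_assoc, mul_smul_comm, Finset.sum_mul, Finset.mul_sum]
  congr 1
  refine Fintype.sum_equiv (Equiv.ofBijective _ hbij) _ _ (fun h => ?_)
  simp only [Equiv.ofBijective_apply, ← map_mul]
  congr 1; group

theorem pavg_trace [FiniteDimensional ℂ W] (ρ : G →* Module.End ℂ W) (H : Subgroup G) (l : G)
    (hl : ∀ h ∈ H, l⁻¹ * h * l ∈ H) (hc : ∀ h ∈ H, l * h = h * l → h = 1)
    (A : Module.End ℂ W) (hA : ∀ h ∈ H, A * ρ h = ρ h * A) :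
    LinearMap.trace ℂ W (ρ l * pavg ρ H * A) = LinearMap.trace ℂ W (ρ l * A) := by
  classical
  have hmem : ∀ v : H, l⁻¹ * (v : G)⁻¹ * l * v ∈ H := fun v =>
    H.mul_mem (hl _ (H.inv_mem v.2)) v.2
  have hinj : Function.Injective (fun v : H => (⟨l⁻¹ * (v : G)⁻¹ * l * v, hmem v⟩ : H)) := by
    intro a b hab
    have h1 : l⁻¹ * (a : G)⁻¹ * l * a = l⁻¹ * (b : G)⁻¹ * l * b := congrArg Subtype.val hab
    have h2 : (b : G) * (a : G)⁻¹ = 1 := by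
      apply hc _ (H.mul_mem b.2 (H.inv_mem a.2))
      have : (a : G)⁻¹ * l * a = (b : G)⁻¹ * l * b := by
        have := congrArg (fun x => l * x) h1
        simpa [mul_assoc] using this
      calc l * (b * (a : G)⁻¹) = b * ((b : G)⁻¹ * l * b) * (a : G)⁻¹ := by group
        _ = b * ((a : G)⁻¹ * l * a) * (a : G)⁻¹ := by rw [this]
        _ = _ := by group
    exact Subtype.ext (mul_inv_eq_one.1 h2).symm
  have hbij := Finite.injective_iff_bijective.1 hinj
  have hsum : ∑ h : H, ρ h = ∑ v : H, ρ (l⁻¹ * (v : G)⁻¹ * l * v) :=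
    (Fintype.sum_equiv (Equiv.ofBijective _ hbij) _ _ (fun h => rfl)).symm
  unfold pavg
  rw [hsum, mul_smul_comm, smul_mul_assoc, map_smul, Finset.mul_sum, Finset.sum_mul, map_sum]
  have : ∀ v : H, LinearMap.trace ℂ W (ρ l * ρ (l⁻¹ * (v : G)⁻¹ * l * v) * A) =
      LinearMap.trace ℂ W (ρ l * A) := by
    intro v
    have h1 : ρ l * ρ (l⁻¹ * (v : G)⁻¹ * l * v) * A = ρ (v : G)⁻¹ * (ρ l * A * ρ v) := by
      have h2 : ρ l * ρ (l⁻¹ * (v : G)⁻¹ * l * v) = ρ (v : G)⁻¹ * (ρ l * ρ v) := by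
        rw [← map_mul, ← map_mul, ← map_mul]
        congr 1; group
      rw [h2, mul_assoc (ρ l) A, hA v v.2]
      simp only [mul_assoc]
    rw [h1, LinearMap.trace_mul_comm, mul_assoc, ← map_mul, mul_inv_cancel, map_one, mul_one]
  rw [Finset.sum_congr rfl (fun v _ => this v), Finset.sum_const, Finset.card_univ,
    ← Nat.cast_smul_eq_nsmul ℂ, smul_smul, inv_mul_cancel₀, one_smul]
  exact_mod_cast Fintype.card_ne_zero

theorem pavg_prod (ρ : G →* Module.End ℂ W) (H K N : Subgroup G) (hK : K ≤ H) (hN : N ≤ H)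
    (hKN : ∀ h ∈ H, ∃ k ∈ K, ∃ m ∈ N, h = k * m) (hn : ∀ k ∈ K, ∀ m ∈ N, k * m * k⁻¹ ∈ N) :
    pavg ρ H = pavg ρ K * pavg ρ N := by
  have hcomm : pavg ρ N * pavg ρ K = pavg ρ K * pavg ρ N :=
    pavg_comm_of ρ K _ fun k hk => (pavg_conj ρ N k (hn k hk)).symm
  have h1 : pavg ρ H * (pavg ρ K * pavg ρ N) = pavg ρ K * pavg ρ N := by
    apply pavg_absorb
    intro h hh
    obtain ⟨k, hk, m, hm, rfl⟩ := hKN h hh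
    rw [map_mul, mul_assoc, ← hcomm, ← mul_assoc (ρ m), pavg_left ρ N m hm, hcomm, ← mul_assoc,
      pavg_left ρ K k hk]
  have h2 : pavg ρ H * (pavg ρ K * pavg ρ N) = pavg ρ H := by
    rw [← mul_assoc, pavg_absorb' ρ K _ fun k hk => pavg_right ρ H k (hK hk),
      pavg_absorb' ρ N _ fun k hk => pavg_right ρ H k (hN hk)]
  rw [← h2, h1]

end avg

open CategoryTheory
set_option linter.unusedSectionVars false
set_option linter.unusedSimpArgs false

section mats
variable {F : Type} [Field F] [Fintype F] [DecidableEq F] {n : ℕ}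

theorem fin_inv_mem {G : Type} [Group G] [Finite G] (S : Submonoid G) (g : G) (hg : g ∈ S) : g⁻¹ ∈ S := by
  have h1 : g⁻¹ = g ^ (Nat.card G - 1) := by
    rw [inv_eq_iff_mul_eq_one, ← pow_succ', Nat.sub_add_cancel Nat.card_pos, pow_card_eq_one']
  rw [h1]; exact S.pow_mem hg _

/-- matrices supported on a preorder relation -/
def LR (R : Fin n → Fin n → Prop) (h1 : ∀ i, R i i) (h2 : ∀ i j k, R i j → R j k → R i k) :
    Subgroup (Matrix.SpecialLinearGroup (Fin n) F) :=
  let S : Submonoid (Matrix.SpecialLinearGroup (Fin n) F) :=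
    { carrier := {g | ∀ i j, (g : Matrix (Fin n) (Fin n) F) i j ≠ 0 → R i j}
      one_mem' := by
        intro i j h
        by_cases hij : i = j
        · subst hij; exact h1 i
        · simp [hij] at h
      mul_mem' := by
        intro a b ha hb i j h
        rw [Matrix.SpecialLinearGroup.coe_mul, Matrix.mul_apply] at h
        obtain ⟨k, _, hk⟩ := Finset.exists_ne_zero_of_sum_ne_zero h
        exact h2 i k j (ha i k (left_ne_zero_of_mul hk)) (hb k j (right_ne_zero_of_mul hk)) }
  { S with inv_mem' := fun {g} hg => fin_inv_mem S g hg }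

theorem mem_LR {R : Fin n → Fin n → Prop} {h1 h2} {g : Matrix.SpecialLinearGroup (Fin n) F} :
    g ∈ LR R h1 h2 ↔ ∀ i j, (g : Matrix (Fin n) (Fin n) F) i j ≠ 0 → R i j := Iff.rfl

/-- unipotent matrices supported on a transitive relation -/
def UR (R : Fin n → Fin n → Prop) (h2 : ∀ i j k, R i j → R j k → R i k) :
    Subgroup (Matrix.SpecialLinearGroup (Fin n) F) :=
  let S : Submonoid (Matrix.SpecialLinearGroup (Fin n) F) :=
    { carrier := {g | ∀ i j, ((g : Matrix (Fin n) (Fin n) F) - 1) i j ≠ 0 → R i j}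
      one_mem' := by
        intro i j h
        simp at h
      mul_mem' := by
        intro a b ha hb i j h
        have e : ((a * b : Matrix.SpecialLinearGroup (Fin n) F) : Matrix (Fin n) (Fin n) F) - 1 =
          (a.1 - 1) + (b.1 - 1) + (a.1 - 1) * (b.1 - 1) := by
          rw [Matrix.SpecialLinearGroup.coe_mul]; noncomm_ring
        rw [e, Matrix.add_apply, Matrix.add_apply] at h
        by_cases h3 : (a.1 - 1) i j = 0
        · by_cases h4 : (b.1 - 1) i j = 0
          · rw [h3, h4, zero_add, zero_add, Matrix.mul_apply] at h
            obtain ⟨k, _, hk⟩ := Finset.exists_ne_zero_of_sum_ne_zero h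
            exact h2 i k j (ha i k (left_ne_zero_of_mul hk)) (hb k j (right_ne_zero_of_mul hk))
          · exact hb i j h4
        · exact ha i j h3 }
  { S with inv_mem' := fun {g} hg => fin_inv_mem S g hg }

theorem mem_UR {R : Fin n → Fin n → Prop} {h2} {g : Matrix.SpecialLinearGroup (Fin n) F} :
    g ∈ UR R h2 ↔ ∀ i j, ((g : Matrix (Fin n) (Fin n) F) - 1) i j ≠ 0 → R i j := Iff.rfl

/-- unipotent radical attached to a function -/
def Uf (f : Fin n → ℕ) : Subgroup (Matrix.SpecialLinearGroup (Fin n) F) :=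
  UR (fun i j => f i < f j) (fun _ _ _ => lt_trans)

/-- upper unitriangular group -/
def UU : Subgroup (Matrix.SpecialLinearGroup (Fin n) F) := Uf (fun i => i.1)

/-- Levi subgroup attached to a function -/
def Lf (f : Fin n → ℕ) : Subgroup (Matrix.SpecialLinearGroup (Fin n) F) :=
  LR (fun i j => f i = f j) (fun _ => rfl) (fun _ _ _ => Eq.trans)

theorem mem_Uf {f : Fin n → ℕ} {g : Matrix.SpecialLinearGroup (Fin n) F} :
    g ∈ Uf f ↔ ∀ i j, ((g : Matrix (Fin n) (Fin n) F) - 1) i j ≠ 0 → f i < f j := Iff.rfl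

theorem mem_Lf {f : Fin n → ℕ} {g : Matrix.SpecialLinearGroup (Fin n) F} :
    g ∈ Lf f ↔ ∀ i j, (g : Matrix (Fin n) (Fin n) F) i j ≠ 0 → f i = f j := Iff.rfl

theorem UR_conj (R R' : Fin n → Fin n → Prop) (h2 h1' h2')
    (hRR : ∀ i j k l, R' i j → R j k → R' k l → R i l)
    (g u : Matrix.SpecialLinearGroup (Fin n) F) (hg : g ∈ LR R' h1' h2') (hu : u ∈ UR R h2) :
    g * u * g⁻¹ ∈ UR R h2 := by
  intro i j h
  have hg' := (LR R' h1' h2').inv_mem hg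
  have e : ((g * u * g⁻¹ : Matrix.SpecialLinearGroup (Fin n) F) : Matrix (Fin n) (Fin n) F) - 1 =
      g.1 * (u.1 - 1) * (g⁻¹).1 := by
    have h1 : g.1 * (g⁻¹).1 = 1 := by
      rw [← Matrix.SpecialLinearGroup.coe_mul, mul_inv_cancel, Matrix.SpecialLinearGroup.coe_one]
    rw [Matrix.SpecialLinearGroup.coe_mul, Matrix.SpecialLinearGroup.coe_mul, mul_sub, sub_mul,
      mul_one, h1]
  rw [e, Matrix.mul_apply] at h
  obtain ⟨k, _, hk⟩ := Finset.exists_ne_zero_of_sum_ne_zero h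
  have hk1 := left_ne_zero_of_mul hk
  rw [Matrix.mul_apply] at hk1
  obtain ⟨l, _, hl⟩ := Finset.exists_ne_zero_of_sum_ne_zero hk1
  exact hRR i l k j (hg _ _ (left_ne_zero_of_mul hl)) (hu _ _ (right_ne_zero_of_mul hl))
    (hg' _ _ (right_ne_zero_of_mul hk))

theorem Uf_conj (f : Fin n → ℕ) (g u : Matrix.SpecialLinearGroup (Fin n) F) (hg : g ∈ Lf f)
    (hu : u ∈ Uf f) : g * u * g⁻¹ ∈ Uf f :=
  UR_conj _ _ _ _ _ (fun i j k l h1 h2 h3 => by omega) g u hg hu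

/-- diagonal matrices -/
def DD (d : Fin n → F) (hd : ∏ i, d i = 1) : Matrix.SpecialLinearGroup (Fin n) F :=
  ⟨Matrix.diagonal d, by rw [Matrix.det_diagonal, hd]⟩

theorem DD_coe (d : Fin n → F) (hd : ∏ i, d i = 1) :
    (DD d hd : Matrix (Fin n) (Fin n) F) = Matrix.diagonal d := rfl

theorem DD_mul (d e : Fin n → F) (hd : ∏ i, d i = 1) (he : ∏ i, e i = 1) (hde : ∏ i, (d * e) i = 1) :
    DD d hd * DD e he = DD (d * e) hde := by
  ext i j
  rw [Matrix.SpecialLinearGroup.coe_mul, DD_coe, DD_coe, DD_coe, Matrix.diagonal_mul_diagonal]; rfl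

theorem prod_mul_one (d e : Fin n → F) (hd : ∏ i, d i = 1) (he : ∏ i, e i = 1) :
    ∏ i, (d * e) i = 1 := by
  simp [Finset.prod_mul_distrib, hd, he]

theorem prod_pow_one (d : Fin n → F) (hd : ∏ i, d i = 1) (k : ℕ) :
    ∏ i, (d ^ k) i = 1 := by
  simp [Finset.prod_pow, hd]

theorem prod_comp_one (d : Fin n → F) (hd : ∏ i, d i = 1) (σ : Equiv.Perm (Fin n)) :
    ∏ i, (d ∘ σ) i = 1 := by
  rw [← hd]; exact Equiv.prod_comp σ d

theorem DD_pow (d : Fin n → F) (hd : ∏ i, d i = 1) (k : ℕ) :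
    DD d hd ^ k = DD (d ^ k) (prod_pow_one d hd k) := by
  ext i j
  simp [DD_coe, Matrix.diagonal_pow]

theorem DD_one (h) : DD (1 : Fin n → F) h = 1 := by
  ext i j
  simp [DD_coe]

theorem DD_mem_LR (d : Fin n → F) (hd) (R h1 h2) : DD d hd ∈ LR (F := F) (n := n) R h1 h2 := by
  intro i j h
  by_cases hij : i = j
  · subst hij; exact h1 i
  · simp [DD_coe, Matrix.diagonal_apply_ne _ hij] at h

theorem DD_mem_Lf (d : Fin n → F) (hd) (f : Fin n → ℕ) : DD d hd ∈ Lf (F := F) f :=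
  DD_mem_LR d hd _ _ _

theorem DD_comm (d : Fin n → F) (hd) (g : Matrix.SpecialLinearGroup (Fin n) F)
    (h : DD d hd * g = g * DD d hd) (i j : Fin n) (hij : (g : Matrix (Fin n) (Fin n) F) i j ≠ 0) :
    d i = d j := by
  have := congrArg (fun x : Matrix.SpecialLinearGroup (Fin n) F => x.1 i j) h
  simp only [Matrix.SpecialLinearGroup.coe_mul, DD_coe, Matrix.diagonal_mul, Matrix.mul_diagonal] at this
  rw [mul_comm] at this
  exact mul_left_cancel₀ hij this

/-- centralizer in `Uf f` of a diagonal matrix separating the levels is trivial -/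
theorem Uf_cent (f : Fin n → ℕ) (d : Fin n → F) (hd) (hf : ∀ i j, d i = d j → f i = f j)
    (u : Matrix.SpecialLinearGroup (Fin n) F) (hu : u ∈ Uf f) (h : DD d hd * u = u * DD d hd) :
    u = 1 := by
  ext i j
  by_contra hne
  have h1 : ((u : Matrix (Fin n) (Fin n) F) - 1) i j ≠ 0 := by
    rw [Matrix.sub_apply]
    exact sub_ne_zero.2 hne
  have h2 := hu i j h1
  have hij : i ≠ j := by rintro rfl; exact lt_irrefl _ h2
  rw [Matrix.sub_apply, Matrix.one_apply_ne hij, sub_zero] at h1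
  have := hf i j (DD_comm d hd u h i j h1)
  omega

theorem DD_mono (d : Fin n → F) (hd) (σ : Equiv.Perm (Fin n)) (m : Matrix.SpecialLinearGroup (Fin n) F)
    (hm : ∀ i j, (m : Matrix (Fin n) (Fin n) F) i j ≠ 0 → i = σ j) :
    DD d hd * m = m * DD (d ∘ σ) (prod_comp_one d hd σ) := by
  ext i j
  simp only [Matrix.SpecialLinearGroup.coe_mul, DD_coe, Matrix.diagonal_mul, Matrix.mul_diagonal]
  by_cases h : (m : Matrix (Fin n) (Fin n) F) i j = 0
  · rw [h]; simp
  · rw [hm i j h]; simp [mul_comm]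

theorem mkU (N : Matrix (Fin n) (Fin n) F) (hN : ∀ i j, N i j ≠ 0 → i < j) :
    ∃ u : Matrix.SpecialLinearGroup (Fin n) F, (u : Matrix (Fin n) (Fin n) F) = 1 + N := by
  refine ⟨⟨1 + N, ?_⟩, rfl⟩
  have h0 : ∀ i j, j ≤ i → N i j = 0 := by
    intro i j hij
    by_contra h
    exact absurd (hN i j h) (not_lt.2 hij)
  rw [Matrix.det_of_isUpperTriangular]
  · apply Finset.prod_eq_one
    intro i _
    simp [h0 i i le_rfl]
  · intro i j hij
    have hij' : j < i := hij
    simp [h0 i j hij'.le, Matrix.one_apply_ne hij'.ne']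

theorem mem_UU_of (N : Matrix (Fin n) (Fin n) F) (hN : ∀ i j, N i j ≠ 0 → i < j)
    (u : Matrix.SpecialLinearGroup (Fin n) F) (hu : (u : Matrix (Fin n) (Fin n) F) = 1 + N) :
    u ∈ UU (F := F) (n := n) := by
  intro i j h
  rw [hu, add_sub_cancel_left] at h
  exact hN i j h

theorem exists_mono (σ : Equiv.Perm (Fin n)) : ∃ m : Matrix.SpecialLinearGroup (Fin n) F,
    ∀ i j, (m : Matrix (Fin n) (Fin n) F) i j ≠ 0 → i = σ j := by
  rcases Nat.eq_zero_or_pos n with h0 | h0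
  · subst h0; exact ⟨1, fun i => i.elim0⟩
  let i0 : Fin n := ⟨0, h0⟩
  let c : Fin n → F := Function.update 1 i0 ((Equiv.Perm.sign σ : ℤ) : F)
  refine ⟨⟨(σ⁻¹).permMatrix F * Matrix.diagonal c, ?_⟩, ?_⟩
  · rw [Matrix.det_mul, Matrix.det_permutation, Matrix.det_diagonal, Finset.prod_update_of_mem (Finset.mem_univ _)]
    simp
    rcases Int.units_eq_one_or (Equiv.Perm.sign σ) with h | h <;> simp [h]
  · intro i j h
    simp only [Matrix.mul_diagonal] at h
    have h1 := left_ne_zero_of_mul h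
    rw [Equiv.Perm.permMatrix, PEquiv.toMatrix_apply] at h1
    by_contra hne
    apply h1
    rw [if_neg]
    simp only [Equiv.toPEquiv_apply, Option.mem_def, Option.some.injEq]
    rintro rfl
    simp at hne
end mats

open CategoryTheory
set_option linter.unusedSectionVars false
set_option linter.unusedSimpArgs false

section bruhat
variable {F : Type} [Field F] [Fintype F] [DecidableEq F] {n : ℕ}

theorem bruhat_aux (g : Matrix.SpecialLinearGroup (Fin n) F) (k : ℕ) (hk : k ≤ n) :
    ∃ u ∈ UU (F := F) (n := n), ∃ u' ∈ UU (F := F) (n := n), ∃ r : Fin n → Fin n,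
      ∀ j : Fin n, j.1 < k → (∀ i, (u * g * u').1 i j ≠ 0 → i = r j) ∧
        (u * g * u').1 (r j) j ≠ 0 ∧ (∀ l, (u * g * u').1 (r j) l ≠ 0 → l = j) := by
  induction k with
  | zero => exact ⟨1, one_mem _, 1, one_mem _, id, fun j hj => absurd hj (Nat.not_lt_zero _)⟩
  | succ k ih =>
    obtain ⟨u, hu, u', hu', r, hr⟩ := ih (by omega)
    obtain ⟨M, hM⟩ : ∃ M, M = u * g * u' := ⟨_, rfl⟩
    rw [← hM] at hr
    let kk : Fin n := ⟨k, by omega⟩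
    -- pivot
    have hcol : ∃ i, M.1 i kk ≠ 0 := by
      by_contra hcon
      push Not at hcon
      have := M.2
      rw [Matrix.det_eq_zero_of_column_eq_zero kk hcon] at this
      exact zero_ne_one this
    obtain ⟨i, hi, hmax⟩ : ∃ i, M.1 i kk ≠ 0 ∧ ∀ a, i < a → M.1 a kk = 0 := by
      have hne : (Finset.univ.filter fun i => M.1 i kk ≠ 0).Nonempty := by
        obtain ⟨i, hi⟩ := hcol
        exact ⟨i, by simp [hi]⟩
      refine ⟨_, (Finset.mem_filter.1 (Finset.max'_mem _ hne)).2, fun a ha => ?_⟩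
      by_contra h
      exact absurd (Finset.le_max' _ a (by simp [h])) (not_le.2 ha)
    have hrow : ∀ j : Fin n, j.1 < k → M.1 i j = 0 := by
      intro j hj
      by_contra h
      have h1 := (hr j hj).1 i h
      have h2 := (hr j hj).2.2 kk (by rw [← h1]; exact hi)
      have := congrArg Fin.val h2
      simp only [kk] at this
      omega
    have hrk : ∀ j : Fin n, j.1 < k → M.1 (r j) kk = 0 := by
      intro j hj
      by_contra h
      have := congrArg Fin.val ((hr j hj).2.2 kk h)
      simp only [kk] at this
      omega
    have hri : ∀ j : Fin n, j.1 < k → r j ≠ i := by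
      intro j hj h
      exact hi (h ▸ hrk j hj)
    let A : Matrix (Fin n) (Fin n) F := Matrix.of fun a b => if b = i ∧ a < i then -(M.1 a kk / M.1 i kk) else 0
    let B : Matrix (Fin n) (Fin n) F := Matrix.of fun a b => if a = kk ∧ kk < b then -(M.1 i b / M.1 i kk) else 0
    have hA : ∀ a b, A a b ≠ 0 → a < b := by
      intro a b h
      simp only [A, Matrix.of_apply, ne_eq, ite_eq_right_iff, not_forall] at h
      obtain ⟨⟨h1, h2⟩, -⟩ := h
      rw [h1]; exact h2
    have hB : ∀ a b, B a b ≠ 0 → a < b := by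
      intro a b h
      simp only [B, Matrix.of_apply, ne_eq, ite_eq_right_iff, not_forall] at h
      obtain ⟨⟨h1, h2⟩, -⟩ := h
      rw [h1]; exact h2
    obtain ⟨ua, hua⟩ := mkU A hA
    obtain ⟨ub, hub⟩ := mkU B hB
    have hM' : ua * u * g * (u' * ub) = ua * M * ub := by rw [hM]; group
    refine ⟨ua * u, mul_mem (mem_UU_of A hA ua hua) hu, u' * ub, mul_mem hu' (mem_UU_of B hB ub hub),
      Function.update r kk i, ?_⟩
    rw [hM']
    have e1 : ∀ a b, ((1 + A) * M.1) a b = if a = i then M.1 i b else M.1 a b - M.1 a kk / M.1 i kk * M.1 i b := by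
      intro a b
      rw [add_mul, one_mul, Matrix.add_apply, Matrix.mul_apply, Finset.sum_eq_single i]
      · simp only [A, Matrix.of_apply, true_and]
        split_ifs with h1 h2 h2
        · exact absurd h2 h1.ne
        · ring
        · subst h2; ring
        · have : M.1 a kk = 0 := hmax a (lt_of_le_of_ne (not_lt.1 h1) (Ne.symm h2))
          rw [this]; ring
      · intro c _ hc
        simp [A, hc]
      · simp
    have e2 : ∀ a b, (ua * M * ub).1 a b =
        if a = i then (if b = kk then M.1 i kk else 0) else M.1 a b - M.1 a kk / M.1 i kk * M.1 i b := by
      intro a b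
      rw [Matrix.SpecialLinearGroup.coe_mul, Matrix.SpecialLinearGroup.coe_mul, hua, hub, mul_add, mul_one,
        Matrix.add_apply, Matrix.mul_apply (M := (1 + A) * M.1), Finset.sum_eq_single kk]
      · rw [e1, e1]
        simp only [B, Matrix.of_apply, true_and]
        by_cases ha : a = i
        · rw [if_pos ha, if_pos ha, if_pos ha]
          split_ifs with h1 h2 h2
          · exact absurd h2 h1.ne'
          · field_simp; ring
          · rw [h2]; ring
          · have : M.1 i b = 0 := hrow b (by
              have h3 : b < kk := lt_of_le_of_ne (not_lt.1 h1) h2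
              exact h3)
            rw [this]; ring
        · rw [if_neg ha, if_neg ha, if_neg ha]
          have : M.1 a kk - M.1 a kk / M.1 i kk * M.1 i kk = 0 := by field_simp; ring
          rw [this]; ring
      · intro c _ hc
        simp [B, hc]
      · simp
    intro j hj
    by_cases hjk : j = kk
    · subst hjk
      rw [Function.update_self]
      refine ⟨?_, ?_, ?_⟩
      · intro a ha
        by_contra hne
        rw [e2, if_neg hne] at ha
        apply ha; field_simp; ring
      · rw [e2]; simpa using hi
      · intro l hl
        by_contra hne
        rw [e2] at hl
        simp [hne] at hl
    · have hj' : j.1 < k := by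
        have : j.1 ≠ k := fun h => hjk (Fin.ext h)
        omega
      rw [Function.update_of_ne hjk]
      have h3 : ∀ a, (ua * M * ub).1 a j = M.1 a j := by
        intro a
        rw [e2]
        rw [if_neg hjk]
        split_ifs with h1
        · rw [h1, hrow j hj']
        · rw [hrow j hj']; ring
      have h4 : ∀ b, (ua * M * ub).1 (r j) b = M.1 (r j) b := by
        intro b
        rw [e2, if_neg (hri j hj'), hrk j hj']; ring
      refine ⟨?_, ?_, ?_⟩
      · intro a ha; rw [h3] at ha; exact (hr j hj').1 a ha
      · rw [h3]; exact (hr j hj').2.1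
      · intro l hl; rw [h4] at hl; exact (hr j hj').2.2 l hl

theorem bruhat (g : Matrix.SpecialLinearGroup (Fin n) F) :
    ∃ u ∈ UU (F := F) (n := n), ∃ u' ∈ UU (F := F) (n := n), ∃ σ : Equiv.Perm (Fin n),
      ∃ m : Matrix.SpecialLinearGroup (Fin n) F,
      (∀ i j, (m : Matrix (Fin n) (Fin n) F) i j ≠ 0 → i = σ j) ∧ g = u * m * u' := by
  obtain ⟨u, hu, u', hu', r, hr⟩ := bruhat_aux g n le_rfl
  have hinj : Function.Injective r := by
    intro a b hab
    have h1 := (hr b b.2).2.2 a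
    rw [← hab] at h1
    exact h1 (hr a a.2).2.1
  refine ⟨u⁻¹, inv_mem hu, u'⁻¹, inv_mem hu', Equiv.ofBijective r (Finite.injective_iff_bijective.1 hinj),
    u * g * u', fun i j h => (hr j j.2).1 i h, by group⟩

/-- the step function merging `k` and `k+1` -/
def fk (k : ℕ) (i : Fin n) : ℕ := if i.1 = k + 1 then k else i.1

/-- root subgroup -/
def Ualpha (k : ℕ) : Subgroup (Matrix.SpecialLinearGroup (Fin n) F) :=
  UR (fun i j => i.1 = k ∧ j.1 = k + 1) (fun i j l h1 h2 => by omega)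

theorem Ualpha_le_UU (k : ℕ) : Ualpha (F := F) (n := n) k ≤ UU := by
  intro u hu i j h
  have := hu i j h
  show i.1 < j.1
  omega

theorem Ufk_le_UU (k : ℕ) : Uf (F := F) (n := n) (fk k) ≤ UU := by
  intro u hu i j h
  have := hu i j h
  show i.1 < j.1
  simp only [fk] at this
  split_ifs at this <;> omega

theorem Ualpha_le_Lf (k : ℕ) : Ualpha (F := F) (n := n) k ≤ Lf (fk k) := by
  intro u hu i j h
  by_cases hij : i = j
  · rw [hij]
  · have := hu i j (by rw [Matrix.sub_apply, Matrix.one_apply_ne hij, sub_zero]; exact h)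
    simp only [fk]
    split_ifs <;> omega

theorem UU_factor (k : ℕ) (u : Matrix.SpecialLinearGroup (Fin n) F) (hu : u ∈ UU (F := F) (n := n)) :
    ∃ a ∈ Ualpha (F := F) (n := n) k, ∃ m ∈ Uf (F := F) (n := n) (fk k), u = a * m := by
  by_cases hk : k + 1 < n
  · let k0 : Fin n := ⟨k, by omega⟩
    let k1 : Fin n := ⟨k + 1, hk⟩
    have h01 : k0 ≠ k1 := by simp [k0, k1, Fin.ext_iff]
    let A : Matrix (Fin n) (Fin n) F := Matrix.of fun a b => if a = k0 ∧ b = k1 then u.1 k0 k1 else 0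
    have hA' : ∀ a b, A a b ≠ 0 → a = k0 ∧ b = k1 := by
      intro a b h
      by_contra hne
      exact h (by simp only [A, Matrix.of_apply]; rw [if_neg hne])
    obtain ⟨ua, hua⟩ := mkU A (fun a b h => by
      obtain ⟨rfl, rfl⟩ := hA' a b h
      simp [k0, k1, Fin.lt_def])
    have hmem : ua ∈ Ualpha (F := F) (n := n) k := by
      intro i j h
      rw [hua, add_sub_cancel_left] at h
      obtain ⟨rfl, rfl⟩ := hA' i j h
      exact ⟨rfl, rfl⟩
    refine ⟨ua, hmem, ua⁻¹ * u, ?_, by group⟩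
    have hU : ua⁻¹ * u ∈ UU (F := F) (n := n) := mul_mem (inv_mem (Ualpha_le_UU k hmem)) hu
    obtain ⟨w, hw⟩ : ∃ w, w = ua⁻¹ * u := ⟨_, rfl⟩
    rw [← hw] at hU ⊢
    have huw : u = ua * w := by rw [hw]; group
    intro i j h
    have hij : i.1 < j.1 := hU i j h
    by_contra hne
    have h1 : i = k0 ∧ j = k1 := by
      simp only [fk] at hne
      constructor <;> apply Fin.ext <;> simp only [k0, k1] <;> split_ifs at hne <;> omega
    obtain ⟨rfl, rfl⟩ := h1
    have h2 : u.1 k0 k1 = w.1 k0 k1 + u.1 k0 k1 * w.1 k1 k1 := by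
      conv_lhs => rw [huw, Matrix.SpecialLinearGroup.coe_mul, hua, add_mul, one_mul, Matrix.add_apply,
        Matrix.mul_apply]
      rw [Finset.sum_eq_single k1]
      · simp [A]
      · intro c _ hc; simp [A, hc]
      · simp
    have h3 : w.1 k1 k1 = 1 := by
      by_contra h4
      have : k1.1 < k1.1 := hU k1 k1 (by rw [Matrix.sub_apply, Matrix.one_apply_eq]; exact sub_ne_zero.2 h4)
      omega
    rw [h3, mul_one] at h2
    apply h
    rw [Matrix.sub_apply, Matrix.one_apply_ne h01, sub_zero]
    exact left_eq_add.1 (h2.trans (add_comm _ _))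
  · refine ⟨1, one_mem _, u, ?_, by group⟩
    intro i j h
    have hij : i.1 < j.1 := hu i j h
    simp only [fk]
    split_ifs <;> omega

end bruhat

open CategoryTheory
set_option linter.unusedSectionVars false
set_option linter.unusedSimpArgs false

theorem common_eig {ι : Type*} {W : Type} [AddCommGroup W] [Module ℂ W] [FiniteDimensional ℂ W]
    (T : ι → Module.End ℂ W) (hcomm : ∀ i j, T i * T j = T j * T i) (E : Submodule ℂ W) (hE : E ≠ ⊥)
    (hst : ∀ i, ∀ w ∈ E, T i w ∈ E) :
    ∃ v ∈ E, v ≠ 0 ∧ ∃ θ : ι → ℂ, ∀ i, T i v = θ i • v := by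
  obtain ⟨S, ⟨hS1, hS2, hS3⟩, hmin⟩ := (wellFounded_lt (α := Submodule ℂ W)).has_min
    {S | S ≤ E ∧ S ≠ ⊥ ∧ ∀ i, ∀ w ∈ S, T i w ∈ S} ⟨E, le_rfl, hE, hst⟩
  have key : ∀ i, ∃ μ : ℂ, ∀ w ∈ S, T i w = μ • w := by
    intro i
    have : Nontrivial S := Submodule.nontrivial_iff_ne_bot.2 hS2
    obtain ⟨μ, hμ⟩ := Module.End.exists_eigenvalue ((T i).restrict (hS3 i))
    obtain ⟨w, hw⟩ := hμ.exists_hasEigenvector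
    have hw1 : T i w = μ • (w : W) := by
      have := hw.apply_eq_smul
      exact congrArg Subtype.val this
    have hw0 : (w : W) ≠ 0 := fun h => hw.2 (Subtype.ext h)
    let S' := S ⊓ Module.End.eigenspace (T i) μ
    have hmem : S' ∈ {S | S ≤ E ∧ S ≠ ⊥ ∧ ∀ i, ∀ w ∈ S, T i w ∈ S} := by
      refine ⟨inf_le_left.trans hS1, ?_, ?_⟩
      · intro h
        have : (w : W) ∈ S' := ⟨w.2, Module.End.mem_eigenspace_iff.2 hw1⟩
        rw [h, Submodule.mem_bot] at this
        exact hw0 this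
      · rintro j x ⟨hx1, hx2⟩
        refine ⟨hS3 j x hx1, ?_⟩
        have hx2' := Module.End.mem_eigenspace_iff.1 hx2
        apply Module.End.mem_eigenspace_iff.2
        have := congrArg (fun A : Module.End ℂ W => A x) (hcomm i j)
        simp only [Module.End.mul_apply] at this
        rw [this, hx2', map_smul]
    have hle : S' ≤ S := inf_le_left
    have heq : S' = S := by
      by_contra hne
      exact hmin S' hmem (lt_of_le_of_ne hle hne)
    refine ⟨μ, fun x hx => ?_⟩
    rw [← heq] at hx
    exact Module.End.mem_eigenspace_iff.1 hx.2
  choose θ hθ using key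
  obtain ⟨v, hv, hv0⟩ := Submodule.exists_mem_ne_zero_of_ne_bot hS2
  exact ⟨v, hS1 hv, hv0, θ, fun i => hθ i v hv⟩

section tau
variable {F : Type} [Field F] [Fintype F] [DecidableEq F] {n : ℕ}
variable {W : Type} [AddCommGroup W] [Module ℂ W] [FiniteDimensional ℂ W]
variable (ρ : Matrix.SpecialLinearGroup (Fin n) F →* Module.End ℂ W)

theorem trace_levi (f : Fin n → ℕ) (d : Fin n → F) (hd : ∏ i, d i = 1)
    (hf : ∀ i j, d i = d j ↔ f i = f j) (g : Matrix.SpecialLinearGroup (Fin n) F) (k : ℕ)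
    (hg : g ^ k = DD d hd) :
    LinearMap.trace ℂ W (ρ g) = LinearMap.trace ℂ W (ρ g * pavg ρ (Uf f)) := by
  have hgL : g ∈ Lf (F := F) f := by
    intro i j h
    apply (hf i j).1
    apply DD_comm d hd g _ i j h
    rw [← hg, ← pow_succ, ← pow_succ']
  have := pavg_trace ρ (Uf f) g (fun h hh => by
      have := Uf_conj f g⁻¹ h (inv_mem hgL) hh
      rwa [inv_inv] at this)
    (fun h hh hc => Uf_cent f d hd (fun i j => (hf i j).1) h hh (by
      rw [← hg]; exact (Commute.pow_left hc k)))
    1 (fun h _ => by rw [one_mul, mul_one])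
  rw [mul_one, mul_one] at this
  exact this.symm

/-- trace on the `U`-fixed vectors -/
noncomputable def tau (d : Fin n → F) (hd : ∏ i, d i = 1) : ℂ :=
  LinearMap.trace ℂ W (ρ (DD d hd) * pavg ρ UU)

theorem tau_regular (d : Fin n → F) (hd : ∏ i, d i = 1) (hinj : Function.Injective d) :
    LinearMap.trace ℂ W (ρ (DD d hd)) = tau ρ d hd :=
  trace_levi ρ (fun i => i.1) d hd (fun i j => by rw [hinj.eq_iff, Fin.ext_iff]) _ 1 (pow_one _)

theorem tau_swap_aux (k : ℕ) (hk : k + 1 < n) (d : Fin n → F) (hd : ∏ i, d i = 1)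
    (hne : d ⟨k, by omega⟩ ≠ d ⟨k + 1, hk⟩) :
    tau ρ d hd = LinearMap.trace ℂ W (ρ (DD d hd) * pavg ρ (Uf (fk k))) := by
  unfold tau
  rw [pavg_prod ρ UU (Ualpha k) (Uf (fk k)) (Ualpha_le_UU k) (Ufk_le_UU k) (UU_factor k)
    (fun a ha m hm => Uf_conj _ a m (Ualpha_le_Lf k ha) hm), ← mul_assoc]
  apply pavg_trace
  · intro h hh
    have : (DD d hd)⁻¹ ∈ LR (F := F) (n := n) (fun i j => i = j) (fun _ => rfl) (fun _ _ _ => Eq.trans) :=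
      inv_mem (DD_mem_LR _ _ _ _ _)
    have := UR_conj (fun i j => i.1 = k ∧ j.1 = k + 1) _ (fun i j l h1 h2 => by omega) _ _
      (by rintro i j k l rfl h rfl; exact h) _ h this hh
    rwa [inv_inv] at this
  · intro u hu hc
    ext i j
    by_contra h
    have h1 : ((u : Matrix (Fin n) (Fin n) F) - 1) i j ≠ 0 := by
      rw [Matrix.sub_apply]
      exact sub_ne_zero.2 h
    have h2 := hu i j h1
    have hij : i ≠ j := by rintro rfl; omega
    rw [Matrix.sub_apply, Matrix.one_apply_ne hij, sub_zero] at h1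
    have h3 := DD_comm d hd u hc i j h1
    apply hne
    convert h3
    · exact h2.1.symm
    · exact h2.2.symm
  · intro h hh
    exact (pavg_conj ρ _ h (fun m hm => Uf_conj _ h m (Ualpha_le_Lf k hh) hm)).symm

theorem tau_swap (k : ℕ) (hk : k + 1 < n) (d : Fin n → F) (hd : ∏ i, d i = 1) :
    tau ρ d hd = tau ρ (d ∘ Equiv.swap ⟨k, by omega⟩ ⟨k + 1, hk⟩) (prod_comp_one d hd _) := by
  obtain ⟨σ, hσ⟩ : ∃ σ : Equiv.Perm (Fin n), σ = Equiv.swap ⟨k, by omega⟩ ⟨k + 1, hk⟩ := ⟨_, rfl⟩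
  have hσ0 : σ ⟨k, by omega⟩ = ⟨k + 1, hk⟩ := by rw [hσ, Equiv.swap_apply_left]
  have hσ1 : σ ⟨k + 1, by omega⟩ = ⟨k, by omega⟩ := by rw [hσ, Equiv.swap_apply_right]
  have hσ2 : ∀ i : Fin n, i.1 ≠ k → i.1 ≠ k + 1 → σ i = i := by
    intro i h1 h2
    rw [hσ, Equiv.swap_apply_of_ne_of_ne] <;> intro h <;> simp [h] at h1 h2
  simp_rw [← hσ]
  by_cases hne : d ⟨k, by omega⟩ = d ⟨k + 1, hk⟩
  · congr 1
    funext i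
    simp only [Function.comp]
    by_cases h1 : i.1 = k
    · have : i = ⟨k, by omega⟩ := Fin.ext h1
      rw [this, hσ0, hne]
    · by_cases h2 : i.1 = k + 1
      · have : i = ⟨k + 1, by omega⟩ := Fin.ext h2
        rw [this, hσ1, hne]
      · rw [hσ2 i h1 h2]
  · rw [tau_swap_aux ρ k hk d hd hne, tau_swap_aux ρ k hk (d ∘ σ) _ (by
      simp only [Function.comp]; rw [hσ0, hσ1]; exact Ne.symm hne)]
    obtain ⟨m, hm⟩ := exists_mono (F := F) σ
    have hmL : m ∈ Lf (F := F) (fk k) := by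
      intro i j h
      rw [hm i j h]
      by_cases h1 : j.1 = k
      · have : j = ⟨k, by omega⟩ := Fin.ext h1
        rw [this, hσ0]; simp [fk]
      · by_cases h2 : j.1 = k + 1
        · have : j = ⟨k + 1, by omega⟩ := Fin.ext h2
          rw [this, hσ1]; simp [fk]
        · rw [hσ2 j h1 h2]
    have hD := DD_mono d hd σ m hm
    have hD' : DD (d ∘ σ) (prod_comp_one d hd σ) = m⁻¹ * DD d hd * m := by
      rw [mul_assoc, hD]; group
    have hcj := pavg_conj ρ _ m (fun u hu => Uf_conj _ m u hmL hu)
    have hT : ρ (DD (d ∘ σ) (prod_comp_one d hd σ)) * pavg ρ (Uf (fk k)) =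
        ρ m⁻¹ * (ρ (DD d hd) * pavg ρ (Uf (fk k)) * ρ m) := by
      rw [hD', ρ.map_mul, ρ.map_mul, mul_assoc _ (ρ m), hcj]
      simp only [mul_assoc]
    rw [hT, LinearMap.trace_mul_comm ℂ (ρ m⁻¹), mul_assoc _ (ρ m), ← ρ.map_mul, mul_inv_cancel, ρ.map_one, mul_one]


theorem weight_vec (v : W) (hvU : ∀ u ∈ UU (F := F) (n := n), ρ u v = v)
    (θ : (Fin n → F) → ℂ) (hθ : ∀ d hd, ρ (DD d hd) v = θ d • v)
    (g : Matrix.SpecialLinearGroup (Fin n) F) : ∃ σ : Equiv.Perm (Fin n),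
    ∀ (f : Fin n → ℕ) (_ : Monotone f) (d : Fin n → F) (hd : ∏ i, d i = 1)
      (_ : ∀ i j, f i = f j → d i = d j),
      ρ (DD d hd) (pavg ρ (Uf f) (ρ g v)) = θ (d ∘ σ) • pavg ρ (Uf f) (ρ g v) := by
  obtain ⟨u, hu, u', hu', σ, m, hm, rfl⟩ := bruhat g
  refine ⟨σ, fun f hf d hd hfd => ?_⟩
  obtain ⟨x, hx⟩ : ∃ x, x = DD d hd := ⟨_, rfl⟩
  have hw : x * u * x⁻¹ * u⁻¹ ∈ Uf (F := F) f := by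
    intro i j h
    have e : ((x * u * x⁻¹ * u⁻¹ : Matrix.SpecialLinearGroup (Fin n) F) : Matrix (Fin n) (Fin n) F) - 1 =
      (x.1 * u.1 - u.1 * x.1) * (x⁻¹ * u⁻¹).1 := by
      rw [← Matrix.SpecialLinearGroup.coe_mul, ← Matrix.SpecialLinearGroup.coe_mul, sub_mul,
        ← Matrix.SpecialLinearGroup.coe_mul, ← Matrix.SpecialLinearGroup.coe_mul,
        ← Matrix.SpecialLinearGroup.coe_one (n := Fin n) (R := F)]
      have e1 : x * u * x⁻¹ * u⁻¹ = x * u * (x⁻¹ * u⁻¹) := by group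
      have e2 : (1 : Matrix.SpecialLinearGroup (Fin n) F) = u * x * (x⁻¹ * u⁻¹) := by group
      rw [e1, ← e2]
    rw [e, Matrix.mul_apply] at h
    obtain ⟨k, _, hk⟩ := Finset.exists_ne_zero_of_sum_ne_zero h
    have h1 := left_ne_zero_of_mul hk
    have h2 := right_ne_zero_of_mul hk
    have hup : UU (F := F) (n := n) ≤ LR (fun i j => i ≤ j) (fun i => le_rfl) (fun _ _ _ => le_trans) := by
      intro w hw i j h
      by_cases hij : i = j
      · exact hij.le
      · have : i < j := hw i j (by rw [Matrix.sub_apply, Matrix.one_apply_ne hij, sub_zero]; exact h)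
        exact this.le
    have h3 : k ≤ j := by
      have : x⁻¹ * u⁻¹ ∈ LR (F := F) (n := n) (fun i j => i ≤ j) (fun i => le_rfl) (fun _ _ _ => le_trans) :=
        mul_mem (inv_mem (by rw [hx]; exact DD_mem_LR _ _ _ _ _)) (inv_mem (hup hu))
      exact this k j h2
    rw [hx, Matrix.sub_apply, DD_coe, Matrix.diagonal_mul, Matrix.mul_diagonal, mul_comm, ← mul_sub] at h1
    have h4 := left_ne_zero_of_mul h1
    have h5 := sub_ne_zero.1 (right_ne_zero_of_mul h1)
    have h6 : i ≤ k := hup hu i k h4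
    exact lt_of_lt_of_le (lt_of_le_of_ne (hf h6) (fun h => h5 (hfd i k h))) (hf h3)
  have h1 : ρ x * pavg ρ (Uf f) = pavg ρ (Uf f) * ρ x :=
    pavg_conj ρ _ x (fun y hy => Uf_conj f x y (by rw [hx]; exact DD_mem_Lf _ _ _) hy)
  have h2 : x * (u * m) = (x * u * x⁻¹ * u⁻¹) * (u * m * DD (d ∘ σ) (prod_comp_one d hd σ)) := by
    rw [mul_assoc u m, ← DD_mono d hd σ m hm, ← hx]; group
  have h3 : pavg ρ (Uf f) * ρ x * ρ (u * m) =
      pavg ρ (Uf f) * ρ (u * m) * ρ (DD (d ∘ σ) (prod_comp_one d hd σ)) := by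
    rw [mul_assoc, ← map_mul, h2, map_mul, ← mul_assoc, pavg_right ρ _ _ hw, map_mul, mul_assoc]
  have h4 : ρ (u * m * u') v = ρ (u * m) v := by
    rw [map_mul, Module.End.mul_apply, hvU u' hu']
  rw [h4, ← hx]
  have h5 := congrArg (fun A : Module.End ℂ W => A v) h3
  simp only [Module.End.mul_apply, hθ, map_smul] at h5
  have h6 := congrArg (fun A : Module.End ℂ W => A (ρ (u * m) v)) h1
  simp only [Module.End.mul_apply] at h6
  rw [h6, h5]

theorem pow_levi (v : W) (hvU : ∀ u ∈ UU (F := F) (n := n), ρ u v = v)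
    (θ : (Fin n → F) → ℂ) (hθ : ∀ d hd, ρ (DD d hd) v = θ d • v)
    (hspan : Submodule.span ℂ (Set.range fun g => ρ g v) = ⊤) (f : Fin n → ℕ) (hf : Monotone f)
    (d : Fin n → F) (hd : ∏ i, d i = 1) (hfd : ∀ i j, f i = f j → d i = d j) (N : ℕ)
    (hN : ∀ σ : Equiv.Perm (Fin n), θ (d ∘ σ) ^ N = 1) :
    ρ (DD d hd) ^ N * pavg ρ (Uf f) = pavg ρ (Uf f) := by
  apply LinearMap.ext_on hspan
  rintro _ ⟨g, rfl⟩
  obtain ⟨σ, hσ⟩ := weight_vec ρ v hvU θ hθ g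
  have h := hσ f hf d hd hfd
  have : ∀ N : ℕ, (ρ (DD d hd) ^ N) (pavg ρ (Uf f) (ρ g v)) = θ (d ∘ σ) ^ N • pavg ρ (Uf f) (ρ g v) := by
    intro N
    induction N with
    | zero => simp
    | succ N ih => rw [pow_succ', Module.End.mul_apply, ih, map_smul, h, smul_smul, ← pow_succ]
  rw [Module.End.mul_apply, this, hN, one_smul]

theorem tau_formula (v : W) (hvU : ∀ u ∈ UU (F := F) (n := n), ρ u v = v)
    (θ : (Fin n → F) → ℂ) (hθ : ∀ d hd, ρ (DD d hd) v = θ d • v)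
    (hspan : Submodule.span ℂ (Set.range fun g => ρ g v) = ⊤) :
    ∃ (r : ℕ) (σ : Fin r → Equiv.Perm (Fin n)), ∀ d hd, tau ρ d hd = ∑ i, θ (d ∘ σ i) := by
  choose s hs using weight_vec ρ v hvU θ hθ
  let E := LinearMap.range (pavg ρ (UU (F := F) (n := n)))
  let b : Matrix.SpecialLinearGroup (Fin n) F → E := fun g => ⟨pavg ρ UU (ρ g v), ⟨_, rfl⟩⟩
  have hb : Submodule.span ℂ (Set.range b) = ⊤ := by
    have h1 : Submodule.map (pavg ρ (UU (F := F) (n := n))).rangeRestrict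
      (Submodule.span ℂ (Set.range fun g => ρ g v)) = ⊤ := by
      rw [hspan, Submodule.map_top, LinearMap.range_rangeRestrict]
    rw [Submodule.map_span, ← Set.range_comp] at h1
    exact h1
  obtain ⟨κ, a, _, ha, hli⟩ := exists_linearIndependent' ℂ b
  rw [hb] at ha
  let B : Module.Basis κ ℂ E := Module.Basis.mk hli ha.ge
  have : Fintype κ := FiniteDimensional.fintypeBasisIndex B
  let eq := Fintype.equivFin κ
  refine ⟨Fintype.card κ, fun i => s (a (eq.symm i)), fun d hd => ?_⟩
  rw [Equiv.sum_comp eq.symm (fun k => θ (d ∘ s (a k)))]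
  have hst : ∀ g, ρ (DD d hd) (pavg ρ UU (ρ g v)) = θ (d ∘ s g) • pavg ρ UU (ρ g v) := fun g =>
    hs g (fun i => i.1) (fun i j h => h) d hd (fun i j h => by rw [Fin.ext h])
  have hcm : ρ (DD d hd) * pavg ρ (UU (F := F) (n := n)) = pavg ρ UU * ρ (DD d hd) :=
    pavg_conj ρ _ _ (fun y hy => Uf_conj _ _ y (DD_mem_Lf _ _ _) hy)
  have hmem : ∀ w, (ρ (DD d hd) * pavg ρ (UU (F := F) (n := n))) w ∈ E := by
    intro w
    rw [hcm]; exact ⟨_, rfl⟩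
  unfold tau
  rw [← LinearMap.trace_restrict_eq_of_forall_mem E _ hmem]
  classical
  rw [LinearMap.trace_eq_matrix_trace ℂ B, Matrix.trace]
  refine Finset.sum_congr rfl fun k _ => ?_
  rw [Matrix.diag_apply, LinearMap.toMatrix_apply]
  have : (LinearMap.restrict (ρ (DD d hd) * pavg ρ (UU (F := F) (n := n))) (fun x _ => hmem x)) (B k) =
      θ (d ∘ s (a k)) • B k := by
    apply Subtype.ext
    have hB : (B k : W) = pavg ρ UU (ρ (a k) v) := by
      simp only [B, Module.Basis.mk_apply]; rfl
    show (ρ (DD d hd) * pavg ρ (UU (F := F) (n := n))) (B k : W) = _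
    rw [Submodule.coe_smul, hB, Module.End.mul_apply,
      ← Module.End.mul_apply (pavg ρ UU) (pavg ρ UU), pavg_idem, hst]
  rw [this]
  simp

end tau

open CategoryTheory
set_option linter.unusedSectionVars false
set_option linter.unusedSimpArgs false

theorem exists_prim_root (F : Type) [Field F] [Fintype F] (p : ℕ) :
    ∃ t : F, IsPrimitiveRoot t (p ^ (Fintype.card F - 1).factorization p) := by
  classical
  have h1 : p ^ (Fintype.card F - 1).factorization p ∣ Fintype.card Fˣ := by
    rw [Fintype.card_units]; exact Nat.ordProj_dvd _ _
  obtain ⟨g, hg⟩ := IsCyclic.exists_generator (α := Fˣ)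
  have hg' : orderOf g = Fintype.card Fˣ := by
    rw [orderOf_eq_card_of_forall_mem_zpowers hg, Nat.card_eq_fintype_card]
  obtain ⟨k, hk⟩ := h1
  have : IsPrimitiveRoot g (Fintype.card Fˣ) := by rw [← hg']; exact IsPrimitiveRoot.orderOf g
  have h2 := this.pow Fintype.card_pos (hk.trans (mul_comm _ _))
  exact ⟨_, h2.map_of_injective (f := Units.coeHom F) Units.val_injective⟩

theorem gl_fact (F : Type) [Field F] [Fintype F] (n p : ℕ) (hp : p.Prime) (hp2 : Odd p) (hnp : n < p)
    (hpq : p ∣ Fintype.card F - 1) :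
    (Nat.card (GL (Fin n) F)).factorization p = n * (Fintype.card F - 1).factorization p := by
  have := Fact.mk hp
  set q := Fintype.card F with hq
  have hq1 : 1 < q := Fintype.one_lt_card
  have hpnq : ¬ p ∣ q := by
    intro h
    have : p ∣ 1 := by
      have := Nat.dvd_sub h hpq
      rwa [show q - (q - 1) = 1 by omega] at this
    exact hp.one_lt.ne' (Nat.dvd_one.1 this)
  have hfac : ∀ i : Fin n, q ^ n - q ^ (i : ℕ) = q ^ (i : ℕ) * (q ^ (n - i) - 1 ^ (n - i)) := by
    intro i
    rw [Nat.mul_sub, ← pow_add, one_pow, mul_one]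
    congr 2; omega
  have hne : ∀ i : Fin n, q ^ (n - i : ℕ) - 1 ^ (n - i : ℕ) ≠ 0 := by
    intro i
    have : 1 < q ^ (n - i : ℕ) := Nat.one_lt_pow (by omega) hq1
    rw [one_pow]; omega
  rw [Matrix.card_GL_field, Nat.factorization_prod]
  · rw [Finset.sum_apply']
    rw [Finset.sum_congr rfl (g := fun _ => (q - 1).factorization p)]
    · simp
    · intro i _
      rw [hfac, Nat.factorization_mul (pow_ne_zero _ (by omega)) (hne i), Finsupp.add_apply,
        Nat.factorization_pow]
      rw [Nat.factorization_def _ hp, Nat.factorization_def _ hp, 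
        padicValNat.pow_sub_pow hp2 hq1 hpq hpnq (by omega)]
      rw [Finsupp.smul_apply, Nat.factorization_eq_zero_of_not_dvd hpnq,
        padicValNat.eq_zero_of_not_dvd (n := n - i) (Nat.not_dvd_of_pos_of_lt (by omega) (by omega))]
      simp
  · intro i _
    rw [hfac]
    exact mul_ne_zero (pow_ne_zero _ (by omega)) (hne i)

/-- the diagonal embedding -/
noncomputable def dgl (F : Type) [Field F] (n : ℕ) : (Fin n → Fˣ) →* GL (Fin n) F :=
  (Units.map (Matrix.diagonalRingHom (Fin n) F).toMonoidHom).comp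
    (MulEquiv.piUnits (M := fun _ : Fin n => F)).symm.toMonoidHom

theorem dgl_coe (F : Type) [Field F] (n : ℕ) (d : Fin n → Fˣ) :
    (dgl F n d : Matrix (Fin n) (Fin n) F) = Matrix.diagonal (fun i => (d i : F)) := rfl

open scoped Pointwise in
theorem gl_diag {F : Type} [Field F] [Fintype F] {n p : ℕ} (hp : p.Prime) (hp2 : Odd p) (hnp : n < p)
    (hpq : p ∣ Fintype.card F - 1) (x : GL (Fin n) F) (j : ℕ) (hx : x ^ p ^ j = 1) :
    ∃ (h : GL (Fin n) F) (d : Fin n → Fˣ), x * h = h * dgl F n d := by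
  classical
  have := Fact.mk hp
  set b := (Fintype.card F - 1).factorization p
  obtain ⟨t, ht⟩ := exists_prim_root F p
  have : NeZero (p ^ b) := ⟨(pow_pos hp.pos _).ne'⟩
  have hc : Nat.card (rootsOfUnity (p ^ b) F) = p ^ b := ht.card_rootsOfUnity
  let φ : (Fin n → rootsOfUnity (p ^ b) F) →* GL (Fin n) F :=
    (dgl F n).comp (MonoidHom.piMap (fun _ => (rootsOfUnity (p ^ b) F).subtype))
  have hφ : Function.Injective φ := by
    intro d e h
    have h2 := congrArg (fun u : GL (Fin n) F => (u : Matrix (Fin n) (Fin n) F)) h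
    simp only [φ, MonoidHom.comp_apply, dgl_coe] at h2
    have h3 := Matrix.diagonal_injective h2
    ext i
    exact congrFun h3 i
  have hcard : Nat.card φ.range = p ^ (Nat.card (GL (Fin n) F)).factorization p := by
    rw [gl_fact F n p hp hp2 hnp hpq]
    have : Nat.card φ.range = Nat.card (Fin n → rootsOfUnity (p ^ b) F) :=
      Nat.card_range_of_injective hφ
    rw [this, Nat.card_pi]
    simp only [hc, Finset.prod_const, Finset.card_univ, Fintype.card_fin]
    rw [← pow_mul, mul_comm]
  let S := Sylow.ofCard φ.range hcard
  have hz : IsPGroup p (Subgroup.zpowers x) := by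
    intro y
    refine ⟨j, ?_⟩
    obtain ⟨y, k, rfl⟩ := y
    apply Subtype.ext
    change (x ^ k) ^ p ^ j = 1
    rw [← zpow_natCast, ← zpow_mul, mul_comm, zpow_mul, zpow_natCast, hx, one_zpow]
  obtain ⟨Q, hQ⟩ := hz.exists_le_sylow
  obtain ⟨h, hh⟩ := MulAction.exists_smul_eq (GL (Fin n) F) S Q
  have hxQ : x ∈ Q := hQ (Subgroup.mem_zpowers x)
  rw [← hh] at hxQ
  obtain ⟨s, hs, hsx⟩ := Subgroup.mem_smul_pointwise_iff_exists _ _ _ |>.1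
    (show x ∈ MulAut.conj h • (S : Subgroup (GL (Fin n) F)) from hxQ)
  rw [Sylow.coe_ofCard] at hs
  obtain ⟨e, he⟩ := hs
  refine ⟨h, fun i => (e i : Fˣ), ?_⟩
  rw [← hsx, ← he, MulAut.smul_def, MulAut.conj_apply]
  simp only [inv_mul_cancel_right]
  rfl

theorem sl_diag {F : Type} [Field F] [Fintype F] [DecidableEq F] {n p : ℕ} (hn : 2 ≤ n)
    (hp : p.Prime) (hp2 : Odd p) (hnp : n < p)
    (hpq : p ∣ Fintype.card F - 1) (x : Matrix.SpecialLinearGroup (Fin n) F) (j : ℕ) (hx : x ^ p ^ j = 1) :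
    ∃ (h : Matrix.SpecialLinearGroup (Fin n) F) (d : Fin n → F) (hd : ∏ i, d i = 1) (f : Fin n → ℕ),
      Monotone f ∧ (∀ i j, d i = d j ↔ f i = f j) ∧ h⁻¹ * x * h = DD d hd := by
  classical
  obtain ⟨h, d, hhd⟩ := gl_diag hp hp2 hnp hpq (x : GL (Fin n) F) j (by
    rw [← map_pow, hx, map_one])
  let f0 : Fin n → ℕ := fun i => Fintype.equivFin F (d i)
  let σ := Tuple.sort f0
  let A : Matrix (Fin n) (Fin n) F := (h : Matrix (Fin n) (Fin n) F).submatrix id σ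
  have hA : A.det ≠ 0 := by
    have h1 : A.det = _ := Matrix.det_permute' σ (h : Matrix (Fin n) (Fin n) F)
    rw [h1]
    apply mul_ne_zero
    · rcases Int.units_eq_one_or (Equiv.Perm.sign σ) with h | h <;> simp [h]
    · exact (Matrix.isUnit_iff_isUnit_det _ |>.1 h.isUnit).ne_zero
  let s : Fin n → F := fun i => if i = ⟨0, by omega⟩ then A.det⁻¹ else 1
  have hM : (A * Matrix.diagonal s).det = 1 := by
    rw [Matrix.det_mul, Matrix.det_diagonal]
    simp [s, hA]
  have hhd' : (x : Matrix (Fin n) (Fin n) F) * (h : Matrix (Fin n) (Fin n) F) =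
      (h : Matrix (Fin n) (Fin n) F) * Matrix.diagonal (fun i => (d i : F)) := by
    have := congrArg (fun u : GL (Fin n) F => (u : Matrix (Fin n) (Fin n) F)) hhd
    simpa [dgl_coe] using this
  have hAd : (x : Matrix (Fin n) (Fin n) F) * A = A * Matrix.diagonal (fun i => (d (σ i) : F)) := by
    ext i k
    have := congrFun (congrFun hhd' i) (σ k)
    rw [Matrix.mul_diagonal] at this ⊢
    exact this
  have hMd : (x : Matrix (Fin n) (Fin n) F) * (A * Matrix.diagonal s) =
      (A * Matrix.diagonal s) * Matrix.diagonal (fun i => (d (σ i) : F)) := by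
    rw [← mul_assoc, hAd, mul_assoc, mul_assoc, Matrix.diagonal_mul_diagonal, Matrix.diagonal_mul_diagonal]
    congr 2; ext i; rw [mul_comm]
  have hd : ∏ i, (d (σ i) : F) = 1 := by
    have := congrArg Matrix.det hMd
    rw [Matrix.det_mul, Matrix.det_mul (A * Matrix.diagonal s), hM, Matrix.SpecialLinearGroup.det_coe,
      Matrix.det_diagonal] at this
    simpa using this.symm
  let H : Matrix.SpecialLinearGroup (Fin n) F := ⟨A * Matrix.diagonal s, hM⟩
  refine ⟨H, fun i => (d (σ i) : F), hd, f0 ∘ σ, Tuple.monotone_sort f0, ?_, ?_⟩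
  · intro i j
    simp only [f0, Function.comp_apply, Fin.val_inj, EmbeddingLike.apply_eq_iff_eq]
  · rw [mul_assoc, inv_mul_eq_iff_eq_mul]
    apply Subtype.ext
    exact hMd

open CategoryTheory
set_option linter.unusedSectionVars false
set_option linter.unusedSimpArgs false

theorem root_pow {W : Type} [AddCommGroup W] [Module ℂ W] [FiniteDimensional ℂ W] (B : Module.End ℂ W)
    (M N : ℕ) (hB : B ^ M = B ^ N) (z : ℂ) (hz : z ∈ (LinearMap.charpoly B).roots) : z ^ M = z ^ N := by
  have h1 := Polynomial.isRoot_of_mem_roots hz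
  rw [← Module.End.hasEigenvalue_iff_isRoot_charpoly] at h1
  obtain ⟨w, hw⟩ := h1.exists_hasEigenvector
  have h2 := hw.pow_apply M
  rw [hB, hw.pow_apply N] at h2
  exact (smul_left_injective ℂ hw.2 h2).symm

theorem trace_roots {W : Type} [AddCommGroup W] [Module ℂ W] [FiniteDimensional ℂ W] (B : Module.End ℂ W) :
    LinearMap.trace ℂ W B = (LinearMap.charpoly B).roots.sum :=
  Module.End.trace_eq_sum_roots_charpoly_of_splits (IsAlgClosed.splits _)

theorem roots_card {W : Type} [AddCommGroup W] [Module ℂ W] [FiniteDimensional ℂ W] (B : Module.End ℂ W) :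
    (LinearMap.charpoly B).roots.card = Module.finrank ℂ W := by
  rw [← LinearMap.charpoly_natDegree B, Polynomial.splits_iff_card_roots.1 (IsAlgClosed.splits _)]

theorem trace_mem {W : Type} [AddCommGroup W] [Module ℂ W] [FiniteDimensional ℂ W] (B : Module.End ℂ W)
    (N : ℕ) (hB : B ^ (N + 1) = B) : LinearMap.trace ℂ W B ∈ Qcyc N := by
  rw [trace_roots]
  apply multiset_sum_mem
  intro z hz
  have := root_pow B (N + 1) 1 (by rw [hB, pow_one]) z hz
  by_cases h0 : z = 0
  · rw [h0]; exact zero_mem _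
  · apply Qcyc_mem
    rw [pow_succ, pow_one] at this
    exact mul_right_cancel₀ h0 (this.trans (one_mul z).symm)

theorem upper {F : Type} [Field F] [Fintype F] [DecidableEq F] {n : ℕ}
    {W : Type} [AddCommGroup W] [Module ℂ W] [FiniteDimensional ℂ W]
    (ρ : Matrix.SpecialLinearGroup (Fin n) F →* Module.End ℂ W) {p : ℕ} (hn : 2 ≤ n)
    (hp : p.Prime) (hp2 : Odd p) (hnp : n < p) (hpq : p ∣ Fintype.card F - 1)
    (v : W) (hvU : ∀ u ∈ UU (F := F) (n := n), ρ u v = v)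
    (θ : (Fin n → F) → ℂ) (hθ : ∀ d hd, ρ (DD d hd) v = θ d • v)
    (hspan : Submodule.span ℂ (Set.range fun g => ρ g v) = ⊤) (c : ℕ)
    (hc : ∀ d : Fin n → F, ∏ i, d i = 1 → ∀ k : ℕ, d ^ p ^ k = 1 → θ d ^ p ^ c = 1)
    (g : Matrix.SpecialLinearGroup (Fin n) F) :
    LinearMap.trace ℂ W (ρ g) ∈
      Qcyc (p ^ c * ordCompl[p] (Nat.card (Matrix.SpecialLinearGroup (Fin n) F))) := by
  set o := Nat.card (Matrix.SpecialLinearGroup (Fin n) F) with ho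
  have ho0 : o ≠ 0 := Nat.card_pos.ne'
  set m := ordCompl[p] o
  set s := o.factorization p
  have hom : p ^ s * m = o := Nat.ordProj_mul_ordCompl_eq_self o p
  have hcop : (p ^ s).Coprime m := Nat.Coprime.pow_left _ (Nat.coprime_ordCompl hp ho0)
  obtain ⟨k, hk1, hk2⟩ := Nat.chineseRemainder hcop 1 0
  have hgo : ∀ g : Matrix.SpecialLinearGroup (Fin n) F, g ^ o = 1 := fun g => pow_card_eq_one'
  have hkm : ∃ m', k = m * m' := (Nat.modEq_zero_iff_dvd.1 hk2)
  have hx : (g ^ k) ^ p ^ s = 1 := by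
    obtain ⟨m', rfl⟩ := hkm
    rw [← pow_mul, show m * m' * p ^ s = (p ^ s * m) * m' by ring, hom, pow_mul, hgo, one_pow]
  obtain ⟨h, d, hd, f, hf, hfd, hhd⟩ := sl_diag hn hp hp2 hnp hpq (g ^ k) s hx
  set g' := h⁻¹ * g * h with hg'
  have hconj : ∀ N : ℕ, g' ^ N = h⁻¹ * g ^ N * h := by
    intro N
    have := conj_pow (i := N) (a := h⁻¹) (b := g)
    rwa [inv_inv] at this
  have hgk : g' ^ k = DD d hd := by rw [hconj, hhd]
  have htr : LinearMap.trace ℂ W (ρ g) = LinearMap.trace ℂ W (ρ g') := by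
    rw [hg', ρ.map_mul, ρ.map_mul, mul_assoc (ρ h⁻¹), LinearMap.trace_mul_comm ℂ (ρ h⁻¹), mul_assoc,
      ← ρ.map_mul h, mul_inv_cancel, ρ.map_one, mul_one]
  have hd1 : d ^ p ^ s = 1 := by
    have h1 : DD d hd ^ p ^ s = 1 := by
      rw [← hhd]
      have := conj_pow (i := p ^ s) (a := h⁻¹) (b := g ^ k)
      rw [inv_inv] at this
      rw [this, hx]; group
    rw [DD_pow] at h1
    have h2 := congrArg (fun u : Matrix.SpecialLinearGroup (Fin n) F => (u : Matrix (Fin n) (Fin n) F)) h1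
    simp only [DD_coe, Matrix.SpecialLinearGroup.coe_one] at h2
    rw [← Matrix.diagonal_one] at h2
    exact Matrix.diagonal_injective h2
  have hpl := pow_levi ρ v hvU θ hθ hspan f hf d hd (fun i j => (hfd i j).2) (p ^ c) (fun σ => by
    apply hc _ (prod_comp_one d hd σ) s
    ext i
    exact congrFun hd1 (σ i))
  rw [htr, trace_levi ρ f d hd hfd g' k hgk]
  have hgL : g' ∈ Lf (F := F) f := by
    intro i j h
    apply (hfd i j).1
    apply DD_comm d hd g' _ i j h
    rw [← hgk, ← pow_succ, ← pow_succ']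
  have hcomm := pavg_conj ρ (Uf f) g' (fun h hh => Uf_conj f g' h hgL hh)
  have hcm : Commute (ρ g') (pavg ρ (Uf f)) := hcomm
  have hN : ρ g' ^ (p ^ c * m) * pavg ρ (Uf f) = pavg ρ (Uf f) := by
    have h1 : g' ^ (p ^ c * m) = (DD d hd ^ p ^ c) ^ m := by
      rw [← hgk, ← pow_mul, ← pow_mul, pow_eq_pow_iff_modEq]
      have h2 : p ^ c * m ≡ k * (p ^ c * m) [MOD p ^ s * m] := by
        have h3 : 1 * (p ^ c * m) ≡ k * (p ^ c * m) [MOD p ^ s * m] := by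
          have := (hk1.symm.mul_right (p ^ c)).mul_right' m
          rwa [mul_assoc, mul_assoc] at this
        rwa [one_mul] at h3
      rw [hom] at h2
      exact h2.of_dvd (orderOf_dvd_of_pow_eq_one (hgo g'))
    rw [← map_pow, h1, map_pow, map_pow]
    have : ∀ m : ℕ, (ρ (DD d hd) ^ p ^ c) ^ m * pavg ρ (Uf f) = pavg ρ (Uf f) := by
      intro m
      induction m with
      | zero => simp
      | succ m ih => rw [pow_succ, mul_assoc, hpl, ih]
    exact this m
  apply trace_mem
  have hid : ∀ M : ℕ, pavg ρ (Uf (F := F) f) ^ (M + 1) = pavg ρ (Uf f) := by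
    intro M
    induction M with
    | zero => simp
    | succ m ih => rw [pow_succ, ih, pavg_idem]
  rw [hcm.mul_pow, hid, pow_succ', mul_assoc, hN]

open CategoryTheory
set_option linter.unusedSectionVars false
set_option linter.unusedSimpArgs false

theorem sum_sym (n : ℕ) : ∑ i : Fin n, ((n : ℤ) - 1 - 2 * (i : ℕ)) = 0 := by
  have h := Equiv.sum_comp Fin.revPerm (fun i : Fin n => ((n : ℤ) - 1 - 2 * (i : ℕ)))
  have h2 : ∑ i : Fin n, ((n : ℤ) - 1 - 2 * ((Fin.revPerm i : Fin n) : ℕ)) =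
      - ∑ i : Fin n, ((n : ℤ) - 1 - 2 * (i : ℕ)) := by
    rw [← Finset.sum_neg_distrib]
    apply Finset.sum_congr rfl
    intro i _
    rw [Fin.revPerm_apply, Fin.val_rev]
    have := i.2
    omega
  omega

theorem reg_elt {F : Type} [Field F] {n p : ℕ} (hp : p.Prime) (hp2 : Odd p) (hnp : n < p)
    (ζ : F) (hζ : IsPrimitiveRoot ζ p) :
    ∃ h : Fin n → F, ∏ i, h i = 1 ∧ h ^ p = 1 ∧ Function.Injective h := by
  have hz0 : ζ ≠ 0 := hζ.ne_zero hp.ne_zero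
  refine ⟨fun i => ζ ^ ((n : ℤ) - 1 - 2 * (i : ℕ)), ?_, ?_, ?_⟩
  · have : ∀ s : Finset (Fin n), ∏ i ∈ s, ζ ^ ((n : ℤ) - 1 - 2 * (i : ℕ)) =
        ζ ^ (∑ i ∈ s, ((n : ℤ) - 1 - 2 * (i : ℕ))) := by
      intro s
      induction s using Finset.induction_on with
      | empty => simp
      | insert a s ha ih => rw [Finset.prod_insert ha, Finset.sum_insert ha, ih, zpow_add₀ hz0]
    rw [this, sum_sym, zpow_zero]
  · ext i
    change (ζ ^ ((n : ℤ) - 1 - 2 * (i : ℕ))) ^ p = 1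
    rw [← zpow_natCast, ← zpow_mul, mul_comm, zpow_mul, zpow_natCast, hζ.pow_eq_one, one_zpow]
  · intro i j hij
    simp only at hij
    have h1 : ζ ^ (2 * ((j : ℕ) : ℤ) - 2 * (i : ℕ)) = 1 := by
      have : (2 * ((j : ℕ) : ℤ) - 2 * (i : ℕ)) = ((n : ℤ) - 1 - 2 * (i : ℕ)) - ((n : ℤ) - 1 - 2 * (j : ℕ)) := by
        ring
      rw [this, zpow_sub₀ hz0, hij, div_self (zpow_ne_zero _ hz0)]
    rw [hζ.zpow_eq_one_iff_dvd] at h1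
    rw [← mul_sub] at h1
    have h2 : (p : ℤ) ∣ ((j : ℕ) : ℤ) - (i : ℕ) := by
      apply (IsCoprime.dvd_of_dvd_mul_left _ h1)
      rw [Int.isCoprime_iff_gcd_eq_one]
      change Nat.gcd p 2 = 1
      exact hp2.coprime_two_right
    have h3 := Int.eq_zero_of_abs_lt_dvd h2 (by
      rw [abs_lt]; have := i.2; have := j.2; constructor <;> omega)
    apply Fin.ext; omega

section w
variable {F : Type} [Field F] [Fintype F] [DecidableEq F] {n : ℕ}
variable {W : Type} [AddCommGroup W] [Module ℂ W] [FiniteDimensional ℂ W]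
variable (ρ : Matrix.SpecialLinearGroup (Fin n) F →* Module.End ℂ W)

theorem deg_modEq {p : ℕ} (hp : p.Prime) (h : Fin n → F) (hh : ∏ i, h i = 1) (hhp : h ^ p = 1)
    (hinj : Function.Injective h) (t : Multiset ℂ) (ht : ∀ z ∈ t, ∃ k : ℕ, z ^ p ^ k = 1)
    (hs : tau ρ h hh = t.sum) : Module.finrank ℂ W ≡ t.card [MOD p] := by
  rw [← roots_card (ρ (DD h hh))]
  apply red_card p hp _ _ _ ht
  · rw [← trace_roots, tau_regular ρ h hh hinj, hs]
  · intro z hz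
    refine ⟨1, ?_⟩
    have := root_pow (ρ (DD h hh)) p 0 (by
      rw [← map_pow, DD_pow]
      have h1 : DD (h ^ p) (prod_pow_one h hh p) = 1 := by
        apply Subtype.ext
        change Matrix.diagonal (h ^ p) = 1
        rw [hhp]; exact Matrix.diagonal_one
      rw [h1, map_one, pow_zero]) z hz
    rw [pow_one, this, pow_zero]

theorem weight_exists {p : ℕ} (hp : p.Prime) (h : Fin n → F) (hh : ∏ i, h i = 1) (hhp : h ^ p = 1)
    (hinj : Function.Injective h) (hdeg : ¬ p ∣ Module.finrank ℂ W) :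
    ∃ (v : W) (θ : (Fin n → F) → ℂ), v ≠ 0 ∧ (∀ u ∈ UU (F := F) (n := n), ρ u v = v) ∧
      ∀ d hd, ρ (DD d hd) v = θ d • v := by
  classical
  have he : pavg ρ (UU (F := F) (n := n)) ≠ 0 := by
    intro h0
    have := deg_modEq ρ hp h hh hhp hinj 0 (by simp) (by simp [tau, h0])
    rw [Multiset.card_zero, Nat.modEq_zero_iff_dvd] at this
    exact hdeg this
  obtain ⟨v, hvE, hv0, θ, hθ⟩ := common_eig
    (fun d : {d : Fin n → F // ∏ i, d i = 1} => ρ (DD d.1 d.2))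
    (by
      intro d e
      rw [← ρ.map_mul, ← ρ.map_mul, DD_mul _ _ _ _ (prod_mul_one _ _ d.2 e.2),
        DD_mul _ _ _ _ (prod_mul_one _ _ e.2 d.2)]
      congr 2; rw [mul_comm])
    (LinearMap.range (pavg ρ (UU (F := F) (n := n))))
    (by rwa [Ne, LinearMap.range_eq_bot])
    (by
      rintro d _ ⟨w, rfl⟩
      have := pavg_conj ρ (UU (F := F) (n := n)) (DD d.1 d.2)
        (fun h hh => Uf_conj _ _ h (DD_mem_Lf d.1 d.2 _) hh)
      refine ⟨ρ (DD d.1 d.2) w, ?_⟩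
      rw [← Module.End.mul_apply, ← this, Module.End.mul_apply])
  refine ⟨v, fun d => if hd : ∏ i, d i = 1 then θ ⟨d, hd⟩ else 0, hv0, ?_, ?_⟩
  · intro u hu
    obtain ⟨w, rfl⟩ := hvE
    rw [← Module.End.mul_apply, pavg_left ρ UU u hu]
  · intro d hd
    simp only [hd, dif_pos]
    exact hθ ⟨d, hd⟩

theorem theta_mul (v : W) (hv : v ≠ 0) (θ : (Fin n → F) → ℂ) (hθ : ∀ d hd, ρ (DD d hd) v = θ d • v)
    (d e : Fin n → F) (hd : ∏ i, d i = 1) (he : ∏ i, e i = 1) : θ (d * e) = θ d * θ e := by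
  have h1 := hθ (d * e) (prod_mul_one d e hd he)
  rw [← DD_mul d e hd he, ρ.map_mul, Module.End.mul_apply, hθ e he, map_smul, hθ d hd, smul_smul] at h1
  rw [← smul_left_injective ℂ hv h1, mul_comm]

theorem theta_one (v : W) (hv : v ≠ 0) (θ : (Fin n → F) → ℂ) (hθ : ∀ d hd, ρ (DD d hd) v = θ d • v) :
    θ 1 = 1 := by
  have h1 := hθ 1 (by simp)
  rw [DD_one, map_one] at h1
  apply smul_left_injective ℂ hv
  simp only [one_smul]
  exact h1.symm
end w

section th
variable {F : Type} [Field F] [Fintype F] [DecidableEq F] {n : ℕ}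

theorem theta_pow (θ : (Fin n → F) → ℂ) (h1 : θ 1 = 1)
    (hm : ∀ d e : Fin n → F, ∏ i, d i = 1 → ∏ i, e i = 1 → θ (d * e) = θ d * θ e)
    (d : Fin n → F) (hd : ∏ i, d i = 1) (k : ℕ) : θ (d ^ k) = θ d ^ k := by
  induction k with
  | zero => simp [h1]
  | succ k ih => rw [pow_succ, hm _ _ (prod_pow_one d hd k) hd, ih, pow_succ]

theorem theta_prod (θ : (Fin n → F) → ℂ) (h1 : θ 1 = 1)
    (hm : ∀ d e : Fin n → F, ∏ i, d i = 1 → ∏ i, e i = 1 → θ (d * e) = θ d * θ e)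
    {ι : Type} (s : Finset ι) (g : ι → Fin n → F) (hg : ∀ j, ∏ i, g j i = 1) :
    ∏ i, (∏ j ∈ s, g j) i = 1 ∧ θ (∏ j ∈ s, g j) = ∏ j ∈ s, θ (g j) := by
  classical
  induction s using Finset.induction_on with
  | empty => simp [h1]
  | insert a s ha ih =>
    rw [Finset.prod_insert ha, Finset.prod_insert ha]
    exact ⟨prod_mul_one _ _ (hg a) ih.1, by rw [hm _ _ (hg a) ih.1, ih.2]⟩

theorem ppow_tors {p : ℕ} (hp : p.Prime) (d : F) (k : ℕ) (hd : d ^ p ^ k = 1) :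
    d ^ p ^ (Fintype.card F - 1).factorization p = 1 := by
  have h0 : d ≠ 0 := by
    rintro rfl
    rw [zero_pow (pow_pos hp.pos k).ne'] at hd
    exact zero_ne_one hd
  have h1 := orderOf_dvd_of_pow_eq_one hd
  obtain ⟨l, _, hl⟩ := (Nat.dvd_prime_pow hp).1 h1
  have h2 := orderOf_dvd_of_pow_eq_one (FiniteField.pow_card_sub_one_eq_one d h0)
  apply orderOf_dvd_iff_pow_eq_one.1
  rw [hl] at h2 ⊢
  have hq : Fintype.card F - 1 ≠ 0 := by have : 1 < Fintype.card F := Fintype.one_lt_card; omega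
  exact pow_dvd_pow p ((hp.pow_dvd_iff_le_factorization hq).1 h2)

/-- coweight element -/
def YY (t : F) (j : Fin n) : Fin n → F := fun i => if i = j then t * (t ^ n)⁻¹ else t

theorem YY_prod (t : F) (ht : t ≠ 0) (j : Fin n) : ∏ i, YY t j i = 1 := by
  have : ∀ i, YY t j i = t * (if i = j then (t ^ n)⁻¹ else 1) := by
    intro i; unfold YY; split_ifs <;> simp
  simp only [this, Finset.prod_mul_distrib]
  simp [ht]

theorem YY_comp (t : F) (j : Fin n) (σ : Equiv.Perm (Fin n)) : YY t j ∘ σ = YY t (σ⁻¹ j) := by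
  ext i
  simp only [YY, Function.comp_apply]
  congr 1
  rw [eq_iff_iff]
  constructor
  · rintro rfl; simp
  · rintro rfl; simp

theorem YY_rel (t : F) (ht : t ≠ 0) (d : Fin n → F) (hd : ∏ i, d i = 1) (k : Fin n → ℕ)
    (hk : ∀ i, t ^ k i = d i) : d ^ n * ∏ j, YY t j ^ k j = 1 := by
  ext i
  simp only [Pi.mul_apply, Pi.pow_apply, Finset.prod_apply, Pi.one_apply]
  have : ∀ j, YY t j i ^ k j = d j * (if j = i then (d i ^ n)⁻¹ else 1) := by
    intro j
    unfold YY
    by_cases h : i = j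
    · subst h
      simp only [if_pos]
      rw [mul_pow, hk, inv_pow, ← pow_mul, mul_comm n, pow_mul, hk]
    · rw [if_neg h, if_neg (Ne.symm h), mul_one, hk]
  simp only [this, Finset.prod_mul_distrib, hd]
  have : d i ≠ 0 := by rw [← hk]; exact pow_ne_zero _ ht
  simp [this]

theorem YY_reg {p b : ℕ} (hp : p.Prime) (hnp : n < p) (hb : 2 ≤ b) (hn : 0 < n) (t : F)
    (ht : IsPrimitiveRoot t (p ^ b)) (h : Fin n → F)
    (hhp : h ^ p = 1) (hinj : Function.Injective h) (j : Fin n) : Function.Injective (YY t j * h) := by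
  have ht0 : t ≠ 0 := ht.ne_zero (pow_pos hp.pos b).ne'
  have key : ∀ i k, i ≠ k → YY t j i = t → YY t j k = t * (t ^ n)⁻¹ → (YY t j * h) i ≠ (YY t j * h) k := by
    intro i k hik hi hk heq
    rw [Pi.mul_apply, Pi.mul_apply, hi, hk, mul_assoc] at heq
    have h1 := mul_left_cancel₀ ht0 heq
    have h2 := congrArg (fun z => z ^ p) h1
    simp only [mul_pow, show ∀ i, h i ^ p = 1 from congrFun hhp] at h2
    have h3 : t ^ (n * p) = 1 := by
      rw [pow_mul, ← inv_inj, ← inv_pow, inv_one]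
      rw [mul_one] at h2
      exact h2.symm
    have h4 := ht.dvd_of_pow_eq_one _ h3
    have h5 : p * p ∣ n * p := ((pow_two p ▸ pow_dvd_pow p hb : p * p ∣ p ^ b)).trans h4
    exact Nat.not_dvd_of_pos_of_lt hn hnp (Nat.dvd_of_mul_dvd_mul_right hp.pos h5)
  intro i k hik
  by_contra hne
  by_cases hi : i = j <;> by_cases hk : k = j
  · exact hne (hi.trans hk.symm)
  · exact key k i (Ne.symm hne) (by simp [YY, hk]) (by simp [YY, hi]) hik.symm
  · exact key i k hne (by simp [YY, hi]) (by simp [YY, hk]) hik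
  · have h1 : YY t j i = t := by simp [YY, hi]
    have h2 : YY t j k = t := by simp [YY, hk]
    rw [Pi.mul_apply, Pi.mul_apply, h1, h2] at hik
    exact hne (hinj (mul_left_cancel₀ ht0 hik))
end th

theorem geom_root {p : ℕ} (w : ℂ) (hw : w ^ p = 1) :
    ∑ k ∈ Finset.range p, w ^ k = if w = 1 then (p : ℂ) else 0 := by
  split_ifs with h
  · simp [h]
  · rw [geom_sum_eq h, hw, sub_self, zero_div]

theorem count_root {p r : ℕ} (hp : p.Prime) (a : Fin r → ℂ) (ha : ∀ i, a i ^ p = 1) (ξ : ℂ) (hξ : ξ ^ p = 1) :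
    (p : ℂ) * ((Finset.univ.filter fun i => a i = ξ).card : ℂ) =
      ∑ k ∈ Finset.range p, (ξ⁻¹) ^ k * ∑ i, a i ^ k := by
  have h0 : ξ ≠ 0 := by
    rintro rfl
    rw [zero_pow hp.ne_zero] at hξ
    exact zero_ne_one hξ
  simp only [Finset.mul_sum, ← mul_pow]
  rw [Finset.sum_comm]
  have : ∀ i, ∑ k ∈ Finset.range p, (ξ⁻¹ * a i) ^ k = if a i = ξ then (p : ℂ) else 0 := by
    intro i
    rw [geom_root _ (by rw [mul_pow, ha, inv_pow, hξ]; simp)]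
    congr 1
    rw [eq_iff_iff, inv_mul_eq_iff_eq_mul₀ h0, mul_one]
  simp only [this]
  rw [← Finset.sum_filter, Finset.sum_const, nsmul_eq_mul, mul_comm]

open CategoryTheory
set_option linter.unusedSectionVars false
set_option linter.unusedSimpArgs false

section fin
variable {F : Type} [Field F] [Fintype F] [DecidableEq F] {n : ℕ}
variable {W : Type} [AddCommGroup W] [Module ℂ W] [FiniteDimensional ℂ W]
variable (ρ : Matrix.SpecialLinearGroup (Fin n) F →* Module.End ℂ W)

theorem tau_YY (t : F) (ht : t ≠ 0) (k : ℕ) (i j : Fin n) :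
    tau ρ (YY t i ^ k) (prod_pow_one _ (YY_prod t ht i) k) =
      tau ρ (YY t j ^ k) (prod_pow_one _ (YY_prod t ht j) k) := by
  have congr_tau : ∀ (d e : Fin n → F) (hd : ∏ i, d i = 1) (he : ∏ i, e i = 1), d = e →
      tau ρ d hd = tau ρ e he := by
    rintro d e hd he rfl; rfl
  have step : ∀ (m : ℕ) (hm : m < n), tau ρ (YY t ⟨m, hm⟩ ^ k) (prod_pow_one _ (YY_prod t ht _) k) =
      tau ρ (YY t ⟨0, by omega⟩ ^ k) (prod_pow_one _ (YY_prod t ht _) k) := by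
    intro m
    induction m with
    | zero => intro _; rfl
    | succ m ih =>
      intro hm
      rw [← ih (by omega), tau_swap ρ m hm]
      apply congr_tau
      have h1 : ∀ σ : Equiv.Perm (Fin n), (YY t ⟨m + 1, hm⟩ ^ k) ∘ σ = (YY t ⟨m + 1, hm⟩ ∘ σ) ^ k := fun _ => rfl
      rw [h1, YY_comp]
      congr 2
      simp
  exact (step i.1 i.2).trans (step j.1 j.2).symm

theorem lower {p c : ℕ} (hn : 2 ≤ n) (hp : p.Prime) (hp2 : Odd p) (hnp : n < p) (hc2 : 2 ≤ c)
    (h : Fin n → F) (hh : ∏ i, h i = 1) (hhp : h ^ p = 1) (hinj : Function.Injective h)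
    (θ : (Fin n → F) → ℂ) (h1 : θ 1 = 1)
    (hm : ∀ d e : Fin n → F, ∏ i, d i = 1 → ∏ i, e i = 1 → θ (d * e) = θ d * θ e)
    (r : ℕ) (hr : ¬ p ∣ r) (σ : Fin r → Equiv.Perm (Fin n)) (hτ : ∀ d hd, tau ρ d hd = ∑ i, θ (d ∘ σ i))
    (hc : ∀ d : Fin n → F, ∏ i, d i = 1 → ∀ k : ℕ, d ^ p ^ k = 1 → θ d ^ p ^ c = 1)
    (hc' : ¬ ∀ d : Fin n → F, ∏ i, d i = 1 → ∀ k : ℕ, d ^ p ^ k = 1 → θ d ^ p ^ (c - 1) = 1) :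
    ∃ (x : Matrix.SpecialLinearGroup (Fin n) F), (∃ j : ℕ, orderOf x = p ^ j) ∧
      LinearMap.trace ℂ W (ρ x) ∈ Qcyc (p ^ c) ∧
      ∀ K : IntermediateField ℚ ℂ, K ≤ Qcyc (p ^ c) → LinearMap.trace ℂ W (ρ x) ∈ K →
        ¬ p ∣ K.relfinrank (Qcyc (p ^ c)) := by
  classical
  have hpw : ∀ (d : Fin n → F), ∏ i, d i = 1 → ∀ k, θ (d ^ k) = θ d ^ k := theta_pow θ h1 hm
  set b := (Fintype.card F - 1).factorization p
  obtain ⟨t, ht⟩ := exists_prim_root F p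
  have htb : IsPrimitiveRoot t (p ^ b) := ht
  have ht0 : t ≠ 0 := ht.ne_zero (pow_pos hp.pos b).ne'
  have : NeZero (p ^ b) := ⟨(pow_pos hp.pos b).ne'⟩
  have hcc : c - 1 + 1 = c := by omega
  push Not at hc'
  obtain ⟨d, hd, k, hdk, hθd⟩ := hc'
  have hdb : ∀ i, d i ^ p ^ b = 1 := fun i => ppow_tors hp (d i) k (congrFun hdk i)
  have hbc : 2 ≤ b := by
    by_contra hb
    apply hθd
    have hle : b ≤ c - 1 := by omega
    have : d ^ p ^ (c - 1) = 1 := by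
      ext i
      have := hdb i
      rw [Pi.pow_apply, Pi.one_apply, ← Nat.sub_add_cancel hle, pow_add, mul_comm, pow_mul, hdb, one_pow]
    rw [← hpw d hd, this, h1]
  have hYp : ∀ j, (YY t j : Fin n → F) ^ p ^ b = 1 := by
    intro j
    ext i
    have : YY t j i ^ p ^ b = 1 := by
      unfold YY
      split_ifs
      · rw [mul_pow, htb.pow_eq_one, inv_pow, ← pow_mul, mul_comm n, pow_mul, htb.pow_eq_one]; simp
      · exact htb.pow_eq_one
    exact this
  have hYP := fun j => YY_prod (n := n) t ht0 j
  -- the values `w j`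
  let w : Fin n → ℂ := fun j => θ (YY t j) ^ p ^ (c - 1)
  have hwp : ∀ j, w j ^ p = 1 := by
    intro j
    simp only [w]
    rw [← pow_mul, ← pow_succ, hcc]
    exact hc _ (hYP j) b (hYp j)
  have hexw : ∃ j, w j ≠ 1 := by
    by_contra hall
    push Not at hall
    choose k _ hk using fun i => htb.eq_pow_of_pow_eq_one (hdb i)
    have hrel := YY_rel t ht0 d hd k hk
    have hP := theta_prod θ h1 hm Finset.univ (fun j => YY t j ^ k j) (fun j => prod_pow_one _ (hYP j) _)
    have h3 := congrArg θ hrel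
    rw [hm _ _ (prod_pow_one d hd n) hP.1, hP.2, h1, hpw d hd] at h3
    have h4 := congrArg (fun z => z ^ p ^ (c - 1)) h3
    simp only [mul_pow, ← Finset.prod_pow, one_pow] at h4
    rw [Finset.prod_eq_one] at h4
    · rw [mul_one, ← pow_mul, mul_comm, pow_mul] at h4
      have h5 : (θ d ^ p ^ (c - 1)) ^ p = 1 := by
        rw [← pow_mul, ← pow_succ, hcc]; exact hc d hd _ hdk
      have h6 := pow_gcd_eq_one.2 ⟨h4, h5⟩
      have h7 : n.gcd p = 1 := by
        apply Nat.Coprime.symm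
        exact (Nat.Prime.coprime_iff_not_dvd hp).2 (Nat.not_dvd_of_pos_of_lt (by omega) hnp)
      rw [h7, pow_one] at h6
      exact hθd h6
    · intro j _
      rw [hpw _ (hYP j), ← pow_mul, mul_comm, pow_mul]
      have := hall j
      simp only [w] at this
      rw [this, one_pow]
  obtain ⟨j1, hj1⟩ := hexw
  set ξ := w j1 with hξ
  have hξp : ξ ^ p = 1 := hwp j1
  -- counts
  let D : Fin n → ℕ := fun j => (Finset.univ.filter fun i : Fin r => w ((σ i)⁻¹ j) = ξ).card
  have hD : ∀ i j, D i = D j := by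
    intro i j
    have hcr : ∀ j, (p : ℂ) * (D j : ℂ) = ∑ k ∈ Finset.range p, (ξ⁻¹) ^ k *
        tau ρ (YY t j ^ (p ^ (c - 1) * k)) (prod_pow_one _ (hYP j) _) := by
      intro j
      rw [count_root hp (fun i => w ((σ i)⁻¹ j)) (fun i => hwp _) ξ hξp]
      apply Finset.sum_congr rfl
      intro k _
      congr 1
      rw [hτ]
      apply Finset.sum_congr rfl
      intro i _
      have h3 : (YY t j ^ (p ^ (c - 1) * k)) ∘ (σ i) = (YY t j ∘ (σ i)) ^ (p ^ (c - 1) * k) := rfl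
      rw [h3, YY_comp, hpw _ (hYP _), pow_mul]
    have h3 : (p : ℂ) * (D i : ℂ) = (p : ℂ) * (D j : ℂ) := by
      rw [hcr, hcr]
      apply Finset.sum_congr rfl
      intro k _
      rw [tau_YY ρ t ht0 _ i j]
    have hp0 : (p : ℂ) ≠ 0 := by exact_mod_cast hp.ne_zero
    exact_mod_cast mul_left_cancel₀ hp0 h3
  let j0 : Fin n := ⟨0, by omega⟩
  have hpD : ¬ p ∣ D j0 := by
    intro hdvd
    have hsum : n * D j0 = r * (Finset.univ.filter fun j : Fin n => w j = ξ).card := by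
      have e1 : ∑ j, D j = n * D j0 := by
        rw [Finset.sum_congr rfl (fun j _ => hD j j0)]; simp
      rw [← e1]
      simp only [D, Finset.card_filter]
      rw [Finset.sum_comm]
      have e2 : ∀ i : Fin r, (∑ j, if w ((σ i)⁻¹ j) = ξ then 1 else 0) = ∑ j, if w j = ξ then 1 else 0 :=
        fun i => Equiv.sum_comp (σ i)⁻¹ (fun j => if w j = ξ then 1 else 0)
      simp only [e2]
      simp
    have h3 : p ∣ r * (Finset.univ.filter fun j : Fin n => w j = ξ).card := hsum ▸ dvd_mul_of_dvd_right hdvd n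
    rcases hp.dvd_mul.1 h3 with h4 | h4
    · exact hr h4
    · refine Nat.not_dvd_of_pos_of_lt ?_ ?_ h4
      · exact Finset.card_pos.2 ⟨j1, by simp [hξ]⟩
      · refine lt_of_le_of_lt (Finset.card_le_univ _) ?_
        simpa using hnp
  -- the element
  let x : Fin n → F := YY t j0 * h
  have hx : ∏ i, x i = 1 := prod_mul_one _ _ (hYP j0) hh
  have hxinj : Function.Injective x := YY_reg hp hnp hbc (by omega) t htb h hhp hinj j0
  have hhb : ∀ e, 1 ≤ e → h ^ p ^ e = 1 := by
    intro e he
    rw [← Nat.sub_add_cancel he, pow_succ', pow_mul, hhp, one_pow]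
  have hxb : x ^ p ^ b = 1 := by
    simp only [x]
    rw [mul_pow, hYp, hhb b (by omega), one_mul]
  let l : Fin r → ℂ := fun i => θ (x ∘ σ i)
  have hl : ∀ i, l i ^ p ^ c = 1 := by
    intro i
    apply hc _ (prod_comp_one x hx (σ i)) b
    have : (x ∘ σ i) ^ p ^ b = (x ^ p ^ b) ∘ σ i := rfl
    rw [this, hxb]; rfl
  have hl' : ∀ i, l i ^ p ^ (c - 1) = w ((σ i)⁻¹ j0) := by
    intro i
    simp only [l, w]
    rw [← hpw _ (prod_comp_one x hx (σ i)), ← hpw _ (hYP _), ← YY_comp]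
    congr 1
    have : (x ∘ σ i) ^ p ^ (c - 1) = (x ^ p ^ (c - 1)) ∘ σ i := rfl
    rw [this]
    simp only [x]
    rw [mul_pow, hhb (c - 1) (by omega), mul_one]
    rfl
  have htr : LinearMap.trace ℂ W (ρ (DD x hx)) = ∑ i, l i := by
    rw [tau_regular ρ x hx hxinj, hτ]
  refine ⟨DD x hx, ?_, ?_, ?_⟩
  · have : DD x hx ^ p ^ b = 1 := by
      rw [DD_pow]
      apply Subtype.ext
      change Matrix.diagonal (x ^ p ^ b) = 1
      rw [hxb]; exact Matrix.diagonal_one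
    obtain ⟨j, _, hj⟩ := (Nat.dvd_prime_pow hp).1 (orderOf_dvd_of_pow_eq_one this)
    exact ⟨j, hj⟩
  · rw [htr]
    exact sum_mem fun i _ => Qcyc_mem _ _ (hl i)
  · intro K hK hmem hdvd
    rw [htr] at hmem
    have hz := class_sum_zero p c hp hp2 hc2 K hK hdvd l hl hmem ξ hξp hj1
    have := red_card p hp (((Finset.univ.filter fun i => l i ^ p ^ (c - 1) = ξ).val).map l) 0
      (by
        intro z hz
        obtain ⟨i, _, rfl⟩ := Multiset.mem_map.1 hz
        exact ⟨c, hl i⟩) (by simp) (by rw [Multiset.sum_zero]; exact hz)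
    rw [Multiset.card_map, Multiset.card_zero, Nat.modEq_zero_iff_dvd] at this
    apply hpD
    simp only [hl'] at this
    exact this
end fin

theorem main13 {F : Type} [Field F] [Fintype F] [DecidableEq F]
    (n : ℕ) (hn : 2 ≤ n) (p : ℕ) (hp : p.Prime)
    (hpq : p ∣ Fintype.card F - 1) (hpn : n * (n - 1) < p)
    (V : FDRep ℂ (Matrix.SpecialLinearGroup (Fin n) F)) (hV : Simple V)
    (hdeg : ¬ p ∣ Module.finrank ℂ V) :
    Property13 V.character p := by
  classical
  have hnp : n < p := by
    refine lt_of_le_of_lt ?_ hpn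
    exact Nat.le_mul_of_pos_right n (by omega)
  have hp2 : Odd p := hp.odd_of_ne_two (by omega)
  set b := (Fintype.card F - 1).factorization p with hb
  have hq : Fintype.card F - 1 ≠ 0 := by have : 1 < Fintype.card F := Fintype.one_lt_card; omega
  have hb1 : 1 ≤ b := (hp.dvd_iff_one_le_factorization hq).1 hpq
  obtain ⟨t, ht⟩ := exists_prim_root F p
  have hζ := ht.pow (pow_pos hp.pos b) (show p ^ b = p ^ (b - 1) * p by rw [← pow_succ]; congr 1; omega)
  obtain ⟨h, hh, hhp, hinj⟩ := reg_elt (n := n) hp hp2 hnp _ hζ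
  let ρ : Matrix.SpecialLinearGroup (Fin n) F →* Module.End ℂ V := V.ρ
  obtain ⟨v, θ, hv0, hvU, hθ⟩ := weight_exists ρ hp h hh hhp hinj hdeg
  have hspan : Submodule.span ℂ (Set.range fun g => ρ g v) = ⊤ := fdrep_span V hV v hv0
  have h1 := theta_one ρ v hv0 θ hθ
  have hm := theta_mul ρ v hv0 θ hθ
  have hpw : ∀ (d : Fin n → F), ∏ i, d i = 1 → ∀ k, θ (d ^ k) = θ d ^ k := theta_pow θ h1 hm
  obtain ⟨r, σ, hτ⟩ := tau_formula ρ v hvU θ hθ hspan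
  have hr : ¬ p ∣ r := by
    have := deg_modEq ρ hp h hh hhp hinj (Finset.univ.val.map fun i => θ (h ∘ σ i))
      (by
        intro z hz
        obtain ⟨i, _, rfl⟩ := Multiset.mem_map.1 hz
        refine ⟨1, ?_⟩
        rw [pow_one, ← hpw _ (prod_comp_one h hh (σ i))]
        have : (h ∘ σ i) ^ p = (h ^ p) ∘ σ i := rfl
        rw [this, hhp]; exact h1) (hτ h hh)
    rw [Multiset.card_map] at this
    have h2 : Module.finrank ℂ V ≡ r [MOD p] := by simpa using this
    exact fun h3 => hdeg ((h2.dvd_iff dvd_rfl).2 h3)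
  have hex : ∃ c : ℕ, ∀ d : Fin n → F, ∏ i, d i = 1 → ∀ k : ℕ, d ^ p ^ k = 1 → θ d ^ p ^ c = 1 := by
    refine ⟨b, fun d hd k hdk => ?_⟩
    rw [← hpw d hd]
    have : d ^ p ^ b = 1 := by
      ext i; exact ppow_tors hp (d i) k (congrFun hdk i)
    rw [this, h1]
  set c := Nat.find hex
  have hc := Nat.find_spec hex
  have hup := upper ρ hn hp hp2 hnp hpq v hvU θ hθ hspan c hc
  set m := ordCompl[p] (Nat.card (Matrix.SpecialLinearGroup (Fin n) F))
  have hm0 : 0 < m := Nat.ordCompl_pos p Nat.card_pos.ne'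
  have hpm : ¬ p ∣ m := Nat.not_dvd_ordCompl hp Nat.card_pos.ne'
  have hchar : ∀ g, V.character g = LinearMap.trace ℂ V (ρ g) := fun g => rfl
  intro f ⟨⟨hf0, hfm⟩, hfmin⟩
  set a := f.factorization p with ha
  have hcm0 : 0 < p ^ c * m := Nat.mul_pos (pow_pos hp.pos c) hm0
  have hfd : f ∣ p ^ c * m := by
    have h2 : f ≤ f.gcd (p ^ c * m) := hfmin ⟨Nat.gcd_pos_of_pos_left _ hf0, fun g => by
      rw [← Qcyc_inf _ _ hf0 hcm0]
      exact ⟨hfm g, hup g⟩⟩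
    have h3 := le_antisymm h2 (Nat.gcd_le_left _ hf0)
    rw [h3]; exact Nat.gcd_dvd_right _ _
  have hac : a ≤ c := by
    have h2 : p ^ a ∣ p ^ c * m := (Nat.ordProj_dvd f p).trans hfd
    have h3 : (p ^ a).Coprime m := Nat.Coprime.pow_left _ ((Nat.Prime.coprime_iff_not_dvd hp).2 hpm)
    exact (Nat.pow_dvd_pow_iff_le_right hp.one_lt).1 (h3.dvd_of_dvd_mul_right h2)
  by_cases ha2 : a ≤ 1
  · refine ⟨1, ⟨0, by simp⟩, fun hdvd => ?_⟩
    have h2 := hdvd.trans (IntermediateField.relfinrank_dvd_finrank_bot _ _)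
    rw [Qcyc_finrank _ (pow_pos hp.pos a)] at h2
    have h3 : a = 0 ∨ a = 1 := by omega
    rcases h3 with h3 | h3
    · rw [h3] at h2
      simp at h2
      exact hp.one_lt.ne' h2
    · rw [h3, pow_one, Nat.totient_prime hp] at h2
      exact Nat.not_dvd_of_pos_of_lt (by omega) (by omega) h2
  · have hc2 : 2 ≤ c := by omega
    have hc' := Nat.find_min hex (show c - 1 < c by omega)
    obtain ⟨x, hxo, hx1, hx2⟩ := lower ρ hn hp hp2 hnp hc2 h hh hhp hinj θ h1 hm r hr σ hτ hc hc'
    refine ⟨x, hxo, ?_⟩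
    have haceq : a = c := by
      by_contra hne
      refine hx2 (Qcyc (p ^ (c - 1))) (Qcyc_mono (pow_dvd_pow p (by omega))) ?_ ?_
      · have h2 : LinearMap.trace ℂ V (ρ x) ∈ Qcyc f ⊓ Qcyc (p ^ c) := ⟨hfm x, hx1⟩
        rw [Qcyc_inf _ _ hf0 (pow_pos hp.pos c)] at h2
        refine Qcyc_mono ?_ h2
        obtain ⟨l, _, hl⟩ := (Nat.dvd_prime_pow hp).1 (Nat.gcd_dvd_right f (p ^ c))
        rw [hl]
        have h3 : p ^ l ∣ f := hl ▸ Nat.gcd_dvd_left f (p ^ c)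
        have h4 := (hp.pow_dvd_iff_le_factorization hf0.ne').1 h3
        exact pow_dvd_pow p (by omega)
      · have h2 := IntermediateField.finrank_bot_mul_relfinrank
          (Qcyc_mono (pow_dvd_pow p (show c - 1 ≤ c by omega)))
        rw [Qcyc_finrank _ (pow_pos hp.pos _), Qcyc_finrank _ (pow_pos hp.pos _)] at h2
        have h3 : (p ^ c).totient = (p ^ (c - 1)).totient * p := by
          rw [Nat.totient_prime_pow hp (by omega), Nat.totient_prime_pow hp (by omega)]
          rw [mul_right_comm, ← pow_succ]
          congr 2; omega
        rw [h3] at h2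
        have h4 := Nat.eq_of_mul_eq_mul_left (Nat.totient_pos.2 (pow_pos hp.pos _)) h2
        rw [h4]
    rw [haceq]
    apply hx2
    · apply IntermediateField.adjoin_le_iff.2
      rw [Set.singleton_subset_iff]
      exact hx1
    · exact IntermediateField.mem_adjoin_simple_self ℚ _

/-- Property 1.3 holds for `SLₙ(F_q)` (`n ≥ 2`, `(n, q) ∉ {(2,2), (2,3)}`)
and any prime `p` with `p ∣ q - 1` and `p > n(n-1)`, for every irreducible character of
degree not divisible by `p`. -/
theorem stmt15 (F : Type) [Field F] [Fintype F] [DecidableEq F]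
    (n : ℕ) (hn : 2 ≤ n)
    (hnq : ¬ (n = 2 ∧ Fintype.card F = 2) ∧ ¬ (n = 2 ∧ Fintype.card F = 3))
    (p : ℕ) (hp : p.Prime)
    (hpq : p ∣ Fintype.card F - 1) (hpn : n * (n - 1) < p)
    (V : FDRep ℂ (Matrix.SpecialLinearGroup (Fin n) F)) (hV : Simple V)
    (hdeg : ¬ p ∣ Module.finrank ℂ V) :
    Property13 V.character p := by
  exact main13 n hn p hp hpq hpn V hV hdeg
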